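/- arXiv:1701.04529 — 2 statements merged into one kernel-verified Lean document; each statement's English description precedes it below -/
import Mathlib

section
/- Let X be a finite set of N ≥ 3 points in ℝ² in general position and in convex position, and let K ≥ 1 be an integer. Then: (i) for every set L of K affine lines in ℝ², each disjoint from X, some cell of L contains at least ⌈N/(2K)⌉ points of X; and (ii) there exists a set L of K distinct affine lines, each disjoint from X, such that every cell of L contains at most ⌈N/(2K)⌉ points of X. -/
open Set

/-- Points of the plane. -/
abbrev Pt := ℝ × ℝ

/-- An affine line in ℝ², given by a nontrivial linear equation. -/
def IsAffLine (l : Set Pt) : Prop :=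
  ∃ a b c : ℝ, (a ≠ 0 ∨ b ≠ 0) ∧ l = {p : Pt | a * p.1 + b * p.2 = c}

/-- An open half-plane in ℝ². -/
def IsOpenHalfPlane (H : Set Pt) : Prop :=
  ∃ a b c : ℝ, (a ≠ 0 ∨ b ≠ 0) ∧ H = {p : Pt | a * p.1 + b * p.2 < c}

/-- `A` and `B` are linearly separable: some affine line has `A` strictly on
one side and `B` strictly on the other side. -/
def LinSep (A B : Set Pt) : Prop :=
  ∃ a b c : ℝ, (a ≠ 0 ∨ b ≠ 0) ∧ (∀ p ∈ A, a * p.1 + b * p.2 < c) ∧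
    (∀ p ∈ B, c < a * p.1 + b * p.2)

/-- General position: no three (distinct) points of `X` are collinear. -/
def GenPos (X : Set Pt) : Prop :=
  ∀ p ∈ X, ∀ q ∈ X, ∀ r ∈ X, p ≠ q → p ≠ r → q ≠ r →
    ¬ Collinear ℝ ({p, q, r} : Set Pt)

/-- Convex position: no point of `X` lies in the convex hull of the others. -/
def ConvexPos (X : Set Pt) : Prop :=
  ∀ p ∈ X, p ∉ convexHull ℝ (X \ {p})

/-- A cell of an arrangement `L` of lines: a connected component of the
complement of the union of the lines. -/
def IsCell (L : Set (Set Pt)) (cell : Set Pt) : Prop :=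
  ∃ p ∈ (⋃₀ L)ᶜ, cell = connectedComponentIn (⋃₀ L)ᶜ p

/-- `S` has at most `d` connected components: among any `d + 1` points of `S`,
two lie in the same connected component of `S`. -/
def CompsLE (S : Set Pt) (d : ℕ) : Prop :=
  ∀ f : Fin (d + 1) → Pt, (∀ i, f i ∈ S) →
    ∃ i j, i ≠ j ∧ connectedComponentIn S (f i) = connectedComponentIn S (f j)

/-- A Jordan curve: the image of a continuous injective map from the unit
circle to the plane. -/
def IsJordanCurve (J : Set Pt) : Prop :=
  ∃ f : EuclideanSpace ℝ (Fin 2) → Pt,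
    ContinuousOn f (Metric.sphere 0 1) ∧ Set.InjOn f (Metric.sphere 0 1) ∧
      J = f '' (Metric.sphere 0 1)

/-- `J` has stabbing number at most `d` (a natural number): every affine line
meets `J` in at most `d` connected components. -/
def StabLE (J : Set Pt) (d : ℕ) : Prop :=
  ∀ l, IsAffLine l → CompsLE (J ∩ l) d

/-- `J` has stabbing number at most a real number `d`: every affine line meets
`J` in at most `⌊d⌋₊` connected components. -/
def StabLER (J : Set Pt) (d : ℝ) : Prop :=
  ∀ l, IsAffLine l → CompsLE (J ∩ l) ⌊d⌋₊

/-- Orientation determinant of three points. -/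
def orr (p q r : Pt) : ℝ := (q.1 - p.1) * (r.2 - p.2) - (q.2 - p.2) * (r.1 - p.1)

lemma orr_cyc (p q r : Pt) : orr p q r = orr q r p := by unfold orr; ring

lemma orr_swap (p q r : Pt) : orr p q r = - orr q p r := by unfold orr; ring

lemma orr_ne {X : Set Pt} (h : GenPos X) {p q r : Pt} (hp : p ∈ X) (hq : q ∈ X) (hr : r ∈ X)
    (h1 : p ≠ q) (h2 : p ≠ r) (h3 : q ≠ r) : orr p q r ≠ 0 := by
  intro h0
  apply h p hp q hq r hr h1 h2 h3
  rw [collinear_iff_of_mem (p₀ := p) (by simp)]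
  refine ⟨q - p, ?_⟩
  have key : ∃ t : ℝ, r = t • (q - p) +ᵥ p := by
    unfold orr at h0
    by_cases hx : q.1 - p.1 = 0
    · have hy : q.2 - p.2 ≠ 0 := by
        intro hy
        exact h1 (Prod.ext (by linarith) (by linarith))
      refine ⟨(r.2 - p.2) / (q.2 - p.2), Prod.ext ?_ ?_⟩
      · simp [hx] at h0 ⊢
        rcases h0 with h0 | h0
        · exact absurd h0 hy
        · linarith
      · simp; field_simp; ring
    · refine ⟨(r.1 - p.1) / (q.1 - p.1), Prod.ext ?_ ?_⟩
      · simp; field_simp; ring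
      · simp; field_simp; linarith
  rintro x (rfl | rfl | rfl)
  · exact ⟨0, by simp⟩
  · exact ⟨1, by simp⟩
  · exact key

lemma no_tri {X : Set Pt} (h : ConvexPos X) {p q r s : Pt} (hp : p ∈ X) (hq : q ∈ X) (hr : r ∈ X)
    (hs : s ∈ X) (h1 : 0 < orr p q r) (h2 : 0 < orr p r s) (h3 : 0 < orr p s q) : False := by
  apply h p hp
  have hqp : q ≠ p := by rintro rfl; simp [orr] at h1
  have hrp : r ≠ p := by rintro rfl; simp [orr] at h1
  have hsp : s ≠ p := by rintro rfl; simp [orr] at h2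
  have Q := subset_convexHull ℝ (X \ {p}) (show q ∈ X \ {p} from ⟨hq, hqp⟩)
  have R := subset_convexHull ℝ (X \ {p}) (show r ∈ X \ {p} from ⟨hr, hrp⟩)
  have S := subset_convexHull ℝ (X \ {p}) (show s ∈ X \ {p} from ⟨hs, hsp⟩)
  have hS : 0 < orr p q r + orr p r s + orr p s q := by positivity
  set T := orr p q r + orr p r s + orr p s q with hT
  have := (convex_convexHull ℝ (X \ {p})).sum_mem (t := Finset.univ)
    (w := ![orr p r s / T, orr p s q / T, orr p q r / T]) (z := ![q, r, s])
    (by intro i _; fin_cases i <;> simp <;> positivity)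
    (by simp [Fin.sum_univ_three]; rw [← add_div, ← add_div, div_eq_one_iff_eq hS.ne']; rw [hT]; ring)
    (by intro i _; fin_cases i <;> simp <;> assumption)
  convert this using 1
  simp [Fin.sum_univ_three]
  have e1 : p.1 * T = orr p r s * q.1 + orr p s q * r.1 + orr p q r * s.1 := by
    rw [hT]; unfold orr; ring
  have e2 : p.2 * T = orr p r s * q.2 + orr p s q * r.2 + orr p q r * s.2 := by
    rw [hT]; unfold orr; ring
  refine Prod.ext ?_ ?_
  · simp; field_simp; linarith
  · simp; field_simp; linarith

lemma exists_sort (M : ℕ) (Y : Type) [Fintype Y] (hcard : Fintype.card Y = M) (R : Y → Y → Prop)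
    (tot : ∀ a b : Y, a ≠ b → R a b ∨ R b a) (asym : ∀ a b : Y, R a b → R b a → False)
    (tr : ∀ a b c : Y, R a b → R b c → R a c) :
    ∃ e : Fin M → Y, Function.Surjective e ∧ ∀ i j, i < j → R (e i) (e j) := by
  classical
  let _ : LinearOrder Y :=
    { le := fun a b => a = b ∨ R a b
      le_refl := fun a => Or.inl rfl
      le_trans := by
        rintro a b c (rfl | h1) (rfl | h2)
        · exact Or.inl rfl
        · exact Or.inr h2
        · exact Or.inr h1
        · exact Or.inr (tr _ _ _ h1 h2)
      le_antisymm := by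
        rintro a b (rfl | h1) (h | h2)
        · rfl
        · rfl
        · exact h.symm
        · exact (asym _ _ h1 h2).elim
      le_total := by
        intro a b
        by_cases hab : a = b
        · exact Or.inl (Or.inl hab)
        · rcases tot a b hab with h | h
          · exact Or.inl (Or.inr h)
          · exact Or.inr (Or.inr h)
      toDecidableLE := Classical.decRel _ }
  let e : Fin M ≃o Y := Fintype.orderIsoFinOfCardEq Y hcard
  refine ⟨e, e.surjective, fun i j hij => ?_⟩
  have hab : e i < e j := e.strictMono hij
  rcases (show e i = e j ∨ R (e i) (e j) from hab.le) with h | h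
  · exact absurd h hab.ne
  · exact h

lemma exists_enum (X : Finset Pt) (N : ℕ) (hN : X.card = N) (hN3 : 3 ≤ N)
    (hgp : GenPos ↑X) (hcp : ConvexPos ↑X) :
    ∃ p : ℕ → Pt, (∀ t < N, p t ∈ X) ∧ (∀ x ∈ X, ∃ t < N, p t = x) ∧
      (∀ i j k, i < j → j < k → k < N → 0 < orr (p i) (p j) (p k)) := by
  classical
  obtain ⟨p0, hp0⟩ : X.Nonempty := Finset.card_pos.1 (by omega)
  obtain ⟨M, rfl⟩ : ∃ M, N = M + 1 := ⟨N - 1, by omega⟩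
  let Y := {x // x ∈ X.erase p0}
  have hY : ∀ y : Y, y.1 ∈ X := fun y => (Finset.mem_erase.1 y.2).2
  have hY0 : ∀ y : Y, p0 ≠ y.1 := fun y => (Finset.mem_erase.1 y.2).1.symm
  have tot : ∀ a b : Y, a ≠ b → 0 < orr p0 a b ∨ 0 < orr p0 b a := by
    intro a b hab
    have h := orr_ne hgp hp0 (hY a) (hY b) (hY0 a) (hY0 b) (fun h => hab (Subtype.ext h))
    have h2 : orr p0 a b = - orr p0 b a := by unfold orr; ring
    rcases lt_or_gt_of_ne h with h | h
    · right; linarith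
    · left; linarith
  have asym : ∀ a b : Y, 0 < orr p0 a b → 0 < orr p0 b a → False := by
    intro a b h1 h2
    have h2 : orr p0 a b = - orr p0 b a := by unfold orr; ring
    linarith
  have tr : ∀ a b c : Y, 0 < orr p0 a b → 0 < orr p0 b c → 0 < orr p0 a c := by
    intro a b c h1 h2
    by_cases hac : a = c
    · subst hac; exact (asym _ _ h1 h2).elim
    rcases tot a c hac with h | h
    · exact h
    · exact (no_tri hcp hp0 (hY a) (hY b) (hY c) h1 h2 h).elim
  have hcard : Fintype.card Y = M := by
    rw [Fintype.card_coe, Finset.card_erase_of_mem hp0, hN]; rfl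
  obtain ⟨e, esurj, emono⟩ := exists_sort M Y hcard (fun a b => 0 < orr p0 a b) tot asym tr
  let p : ℕ → Pt := fun t => if h : 1 ≤ t ∧ t < M + 1 then (e ⟨t - 1, by omega⟩ : Y).1 else p0
  have pz : p 0 = p0 := by simp [p]
  have ps : ∀ t (h : 1 ≤ t ∧ t < M + 1), p t = (e ⟨t - 1, by omega⟩ : Y).1 := by
    intro t h; simp only [p]; rw [dif_pos h]
  have p0jk : ∀ j k, 1 ≤ j → j < k → k < M + 1 → 0 < orr p0 (p j) (p k) := by
    intro j k h1 h2 h3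
    rw [ps j (by omega), ps k (by omega)]
    apply emono
    rw [Fin.lt_def]; simp; omega
  have pX : ∀ t < M + 1, p t ∈ X := by
    intro t ht
    rcases Nat.eq_zero_or_pos t with rfl | h
    · rw [pz]; exact hp0
    · rw [ps t ⟨h, ht⟩]; exact hY _
  refine ⟨p, pX, ?_, ?_⟩
  · intro x hx
    by_cases h : x = p0
    · exact ⟨0, by omega, by rw [pz, h]⟩
    · let y : Y := ⟨x, Finset.mem_erase.2 ⟨h, hx⟩⟩
      obtain ⟨z, hz⟩ := esurj y
      refine ⟨z.1 + 1, by have := z.2; omega, ?_⟩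
      rw [ps _ ⟨by omega, by have := z.2; omega⟩]
      simp only [Nat.add_sub_cancel, Fin.eta]
      rw [hz]
  · intro i j k hij hjk hk
    rcases Nat.eq_zero_or_pos i with rfl | hi
    · rw [pz]; exact p0jk j k (by omega) hjk hk
    · have h1 := p0jk i j hi hij (by omega)
      have h2 := p0jk j k (by omega) hjk hk
      have h3 := p0jk i k hi (by omega) hk
      by_contra hneg
      have ne : ∀ a b, 0 < orr p0 a b → a ≠ b := by
        rintro a b h rfl
        have : orr p0 a a = 0 := by unfold orr; ring
        linarith
      have h4 := orr_ne hgp (pX i (by omega)) (pX j (by omega)) (pX k hk) (ne _ _ h1) (ne _ _ h3)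
        (ne _ _ h2)
      have h5 : orr (p i) (p j) (p k) < 0 := lt_of_le_of_ne (not_lt.1 hneg) h4
      refine no_tri hcp (pX j (by omega)) hp0 (pX i (by omega)) (pX k hk) ?_ ?_ ?_
      · rw [orr_cyc]; exact h1
      · rw [orr_swap] at h5; linarith
      · rw [← orr_cyc]; exact h2

/-- A line does not see an alternating pattern of four points. -/
lemma no_alt {A B C D : Pt} (h1 : 0 < orr A B C) (h2 : 0 < orr A B D) (h3 : 0 < orr A C D)
    (h4 : 0 < orr B C D) (a b c : ℝ) (hA : 0 < a * A.1 + b * A.2 - c)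
    (hB : a * B.1 + b * B.2 - c < 0) (hC : 0 < a * C.1 + b * C.2 - c)
    (hD : a * D.1 + b * D.2 - c < 0) : False := by
  have key : orr B C D * (a * A.1 + b * A.2 - c) + orr A B D * (a * C.1 + b * C.2 - c)
     = orr A C D * (a * B.1 + b * B.2 - c) + orr A B C * (a * D.1 + b * D.2 - c) := by
    unfold orr; ring
  have := mul_pos h4 hA
  have := mul_pos h2 hC
  have := mul_neg_of_pos_of_neg h3 hB
  have := mul_neg_of_pos_of_neg h1 hD
  linarith

lemma changes_card (N : ℕ) (s : ℕ → Prop) [DecidablePred s]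
    (hs : ∀ i j k l, i < j → j < k → k < l → l < N → (s i ↔ ¬ s j) → (s i ↔ s k) →
      (s i ↔ ¬ s l) → False) :
    ((Finset.range N).filter (fun i => ¬ (s i ↔ s (if i + 1 = N then 0 else i + 1)))).card ≤ 2 := by
  by_contra hcon
  replace hcon := not_le.1 hcon
  set D := (Finset.range N).filter (fun i => ¬ (s i ↔ s (if i + 1 = N then 0 else i + 1))) with hD
  obtain ⟨u, hu, hu3⟩ := Finset.exists_subset_card_eq (show 3 ≤ D.card from hcon)
  let f := u.orderEmbOfFin hu3
  have hf : ∀ x, f x < N ∧ ¬ (s (f x) ↔ s (if f x + 1 = N then 0 else f x + 1)) := by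
    intro x
    have := hu (u.orderEmbOfFin_mem hu3 x)
    rw [hD, Finset.mem_filter, Finset.mem_range] at this
    exact this
  have hij : f 0 < f 1 := f.strictMono (by decide)
  have hjk : f 1 < f 2 := f.strictMono (by decide)
  obtain ⟨hi1, hi2⟩ := hf 0
  obtain ⟨hj1, hj2⟩ := hf 1
  obtain ⟨hk1, hk2⟩ := hf 2
  clear hf
  generalize f 0 = i at hij hi1 hi2
  generalize f 1 = j at hij hjk hj1 hj2
  generalize f 2 = k at hjk hk1 hk2
  clear f hu hu3 u hD hcon D
  rw [if_neg (by omega)] at hi2 hj2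
  have hneq : ∀ {a b : ℕ}, ¬ (s a ↔ s b) → a ≠ b := by rintro a b h rfl; exact h Iff.rfl
  obtain ⟨j', hj', hj'1, hj's⟩ : ∃ j', j ≤ j' ∧ j' ≤ j + 1 ∧ (s i ↔ s j') := by
    by_cases h : s i ↔ s j
    · exact ⟨j, le_rfl, by omega, h⟩
    · exact ⟨j + 1, by omega, le_rfl, by tauto⟩
  have hne : j' ≠ i + 1 := (hneq (by tauto))
  have fin : ∀ k', k ≤ k' → k' < N → (s i ↔ ¬ s k') → False := by
    intro k' h1 h2 h3
    have : k' ≠ j' := hneq (by tauto)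
    exact hs i (i+1) j' k' (by omega) (by omega) (by omega) h2 (by tauto) hj's h3
  by_cases hk : s i ↔ s k
  · split_ifs at hk2 with hkN
    · have : i ≠ 0 := hneq (by tauto)
      refine hs 0 i (i+1) j' (by omega) (by omega) (by omega) (by omega) ?_ ?_ ?_ <;> tauto
    · exact fin (k+1) (by omega) (by omega) (by tauto)
  · exact fin k le_rfl hk1 (by tauto)

lemma exists_rep (N : ℕ) (D : Finset ℕ) (hD : D.Nonempty) (hDN : ∀ d ∈ D, d < N) (i : ℕ)
    (hi : i < N) : ∃ d ∈ D, ∀ s : ℕ → Prop,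
      (∀ i < N, i ∉ D → (s i ↔ s (if i + 1 = N then 0 else i + 1))) → (s i ↔ s d) := by
  have chain : ∀ (s : ℕ → Prop), (∀ i < N, i ∉ D → (s i ↔ s (if i + 1 = N then 0 else i + 1))) →
      ∀ a n, a + n < N → (∀ x, a ≤ x → x < a + n → x ∉ D) → (s a ↔ s (a + n)) := by
    intro s hs a n
    induction n with
    | zero => intro _ _; exact Iff.rfl
    | succ n ih =>
      intro h1 h2
      rw [ih (by omega) (fun x hx hx' => h2 x hx (by omega))]
      have := hs (a + n) (by omega) (h2 _ (by omega) (by omega))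
      rwa [if_neg (by omega)] at this
  by_cases h : ∃ d ∈ D, i ≤ d
  · classical
    have hf := Nat.find_spec (p := fun d => d ∈ D ∧ i ≤ d) h
    have hm := fun m => Nat.find_min (p := fun d => d ∈ D ∧ i ≤ d) h (m := m)
    generalize Nat.find (p := fun d => d ∈ D ∧ i ≤ d) h = d at *
    refine ⟨d, hf.1, fun s hs => ?_⟩
    have := chain s hs i (d - i) (by have := hDN d hf.1; omega)
      (fun x hx hx' hxD => hm x (by omega) ⟨hxD, hx⟩)
    rwa [show i + (d - i) = d by omega] at this
  · push Not at h
    refine ⟨D.min' hD, D.min'_mem hD, fun s hs => ?_⟩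
    have h1 := chain s hs i (N - 1 - i) (by omega) (fun x hx hx' hxD => by have := h x hxD; omega)
    have h2 := hs (N - 1) (by omega) (fun hxD => by have := h _ hxD; omega)
    rw [if_pos (by omega)] at h2
    have h3 := chain s hs 0 (D.min' hD) (by have := hDN _ (D.min'_mem hD); omega)
      (fun x hx hx' hxD => by have := D.min'_le x hxD; omega)
    rw [show i + (N - 1 - i) = N - 1 by omega] at h1
    rw [zero_add] at h3
    tauto

lemma ncard_helper (X : Finset Pt) (N K : ℕ) (hN : X.card = N) (hK : 1 ≤ K) (D : Finset ℕ)
    (hD : D.card ≤ 2 * K) (C : ℕ → Set Pt)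
    (hC : ∀ x ∈ X, ∃ d ∈ D, x ∈ C d) (hX : X.Nonempty) :
    ∃ d ∈ D, ⌈(N : ℝ) / (2 * K)⌉ ≤ ((((↑X : Set Pt) ∩ C d).ncard : ℤ)) := by
  classical
  by_contra hcon
  push Not at hcon
  have h1 : ∀ d ∈ D, ((((↑X : Set Pt) ∩ C d).ncard : ℝ)) * (2 * K) < N := by
    intro d hd
    have := hcon d hd
    rw [Int.lt_ceil] at this
    rw [lt_div_iff₀ (by positivity)] at this
    exact_mod_cast this
  have h2 : X.card ≤ ∑ d ∈ D, ((↑X : Set Pt) ∩ C d).ncard := by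
    calc X.card ≤ (D.biUnion (fun d => X.filter (· ∈ C d))).card := by
          apply Finset.card_le_card
          intro x hx
          obtain ⟨d, hd, hxd⟩ := hC x hx
          simp only [Finset.mem_biUnion, Finset.mem_filter]
          exact ⟨d, hd, hx, hxd⟩
      _ ≤ ∑ d ∈ D, (X.filter (· ∈ C d)).card := Finset.card_biUnion_le
      _ = _ := by
          apply Finset.sum_congr rfl
          intro d _
          rw [← Set.ncard_coe_finset]
          congr 1
          ext x; simp
  have hDne : D.Nonempty := by
    obtain ⟨x, hx⟩ := hX
    obtain ⟨d, hd, _⟩ := hC x hx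
    exact ⟨d, hd⟩
  have h3 : (∑ d ∈ D, ((↑X : Set Pt) ∩ C d).ncard) * (2 * K) < D.card * N := by
    rw [Finset.sum_mul]
    calc _ < ∑ d ∈ D, N := Finset.sum_lt_sum_of_nonempty hDne
            (fun d hd => by exact_mod_cast h1 d hd)
      _ = _ := by simp
  have h4 : D.card * N ≤ 2 * K * N := Nat.mul_le_mul_right _ hD
  have h5 := Nat.mul_le_mul_right (2 * K) h2
  rw [hN, mul_comm] at h5
  omega

lemma part_one (X : Finset Pt) (N : ℕ) (hN : X.card = N) (hN3 : 3 ≤ N)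
    (hgp : GenPos ↑X) (hcp : ConvexPos ↑X) (K : ℕ) (hK : 1 ≤ K)
    (L : Finset (Set Pt)) (hL : L.card = K)
    (hLX : ∀ l ∈ L, IsAffLine l ∧ Disjoint l (↑X : Set Pt)) :
    ∃ cell, IsCell ↑L cell ∧
          ⌈(N : ℝ) / (2 * K)⌉ ≤ ((((↑X : Set Pt) ∩ cell).ncard : ℤ)) := by
  classical
  obtain ⟨p, pX, psurj, ptri⟩ := exists_enum X N hN hN3 hgp hcp
  have hl : ∀ l : Set Pt, ∃ a b c : ℝ, l ∈ L → l = {p : Pt | a * p.1 + b * p.2 = c} := by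
    intro l
    by_cases h : l ∈ L
    · obtain ⟨a, b, c, _, h2⟩ := (hLX l h).1
      exact ⟨a, b, c, fun _ => h2⟩
    · exact ⟨0, 0, 0, fun h' => absurd h' h⟩
  choose a b c habc using hl
  let g : Set Pt → Pt → ℝ := fun l q => a l * q.1 + b l * q.2 - c l
  have hg0 : ∀ l ∈ L, ∀ q, q ∈ l ↔ g l q = 0 := by
    intro l hlL q
    rw [show (q ∈ l) = (q ∈ {p : Pt | a l * p.1 + b l * p.2 = c l}) by rw [← habc l hlL]]
    simp [g, sub_eq_zero]
  have hgX : ∀ l ∈ L, ∀ q ∈ X, g l q ≠ 0 := by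
    intro l hlL q hq h0
    exact Set.disjoint_left.1 (hLX l hlL).2 ((hg0 l hlL q).2 h0) hq
  let s : Set Pt → ℕ → Prop := fun l t => 0 < g l (p t)
  let Dl : Set Pt → Finset ℕ := fun l =>
    (Finset.range N).filter (fun i => ¬ (s l i ↔ s l (if i + 1 = N then 0 else i + 1)))
  let D := L.biUnion Dl
  have hDl : ∀ l ∈ L, (Dl l).card ≤ 2 := by
    intro l hlL
    apply changes_card
    intro i j k m hij hjk hkm hm h1 h2 h3
    have ne : ∀ t < N, ¬ s l t → g l (p t) < 0 := fun t ht h =>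
      lt_of_le_of_ne (not_lt.1 h) (hgX l hlL _ (pX t ht))
    have o1 := ptri i j k hij hjk (by omega)
    have o2 := ptri i j m hij (by omega) (by omega)
    have o3 := ptri i k m (by omega) (by omega) (by omega)
    have o4 := ptri j k m (by omega) (by omega) (by omega)
    by_cases hi : s l i
    · exact no_alt o1 o2 o3 o4 (a l) (b l) (c l) hi (ne j (by omega) (by tauto))
        (show s l k by tauto) (ne m (by omega) (by tauto))
    · have hi' := ne i (by omega) hi
      have hj : s l j := by tauto
      have hk := ne k (by omega) (by tauto)
      have hm : s l m := by tauto
      simp only [s, g] at hi' hj hk hm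
      exact no_alt o1 o2 o3 o4 (-a l) (-b l) (-c l) (by linarith) (by linarith) (by linarith)
        (by linarith)
  have hDcard : D.card ≤ 2 * K := by
    have := Finset.card_biUnion_le_card_mul L Dl 2 hDl
    rw [hL] at this; simp only [D]; omega
  have hDN : ∀ d ∈ D, d < N := by
    intro d hd
    simp only [D, Dl, Finset.mem_biUnion, Finset.mem_filter, Finset.mem_range] at hd
    obtain ⟨_, _, h, _⟩ := hd
    exact h
  obtain ⟨E, hDE, hEne, hEN, hEc⟩ : ∃ E : Finset ℕ, D ⊆ E ∧ E.Nonempty ∧ (∀ d ∈ E, d < N) ∧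
      E.card ≤ 2 * K := by
    by_cases h : D.Nonempty
    · exact ⟨D, subset_rfl, h, hDN, hDcard⟩
    · rw [Finset.not_nonempty_iff_eq_empty] at h
      refine ⟨{0}, by simp [h], by simp, by simp; omega, by simp; omega⟩
  have hcompl : ∀ q ∈ X, q ∈ (⋃₀ (↑L : Set (Set Pt)))ᶜ := by
    rintro q hq ⟨l, hlL, hql⟩
    exact Set.disjoint_left.1 (hLX l hlL).2 hql hq
  obtain ⟨d, hd, hcard⟩ := ncard_helper X N K hN hK E hEc
    (fun d => connectedComponentIn (⋃₀ (↑L : Set (Set Pt)))ᶜ (p d)) (by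
      intro x hx
      obtain ⟨t, ht, rfl⟩ := psurj x hx
      obtain ⟨d, hd, hds⟩ := exists_rep N E hEne hEN t ht
      refine ⟨d, hd, ?_⟩
      have same : ∀ l ∈ L, (s l t ↔ s l d) := by
        intro l hlL
        apply hds
        intro i hi hiE
        by_contra hcon
        apply hiE; apply hDE
        simp only [D, Dl, Finset.mem_biUnion, Finset.mem_filter, Finset.mem_range]
        exact ⟨l, hlL, hi, hcon⟩
      have hseg : segment ℝ (p d) (p t) ⊆ (⋃₀ (↑L : Set (Set Pt)))ᶜ := by
        rintro y ⟨u, v, hu, hv, huv, rfl⟩ ⟨l, hlL, hyl⟩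
        have hlL' : l ∈ L := hlL
        rw [hg0 l hlL'] at hyl
        have e : g l (u • p d + v • p t) = u * g l (p d) + v * g l (p t) := by
          simp only [g, Prod.fst_add, Prod.snd_add, Prod.smul_fst, Prod.smul_snd, smul_eq_mul]
          have : v = 1 - u := by linarith
          subst this; ring
        rw [e] at hyl
        have hh := same l hlL'
        have n1 := hgX l hlL' _ (pX t ht)
        have n2 := hgX l hlL' _ (pX d (hEN d hd))
        simp only [s] at hh
        rcases lt_or_gt_of_ne n1 with h1 | h1 <;> rcases lt_or_gt_of_ne n2 with h2 | h2
        · rcases hu.eq_or_lt with rfl | hu'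
          · rw [zero_add] at huv; subst huv; linarith
          · linarith [mul_pos hu' (neg_pos.2 h2), mul_nonneg hv (neg_nonneg.2 h1.le)]
        · exact absurd (hh.2 h2) (by linarith)
        · exact absurd (hh.1 h1) (by linarith)
        · rcases hu.eq_or_lt with rfl | hu'
          · rw [zero_add] at huv; subst huv; linarith
          · linarith [mul_pos hu' h2, mul_nonneg hv h1.le]
      exact (convex_segment (p d) (p t)).isPreconnected.subset_connectedComponentIn
        (left_mem_segment ℝ _ _) hseg (right_mem_segment ℝ _ _)) (Finset.card_pos.1 (by omega))
  exact ⟨_, ⟨p d, hcompl _ (pX d (hEN d hd)), rfl⟩, hcard⟩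

/-- `l` is a line missing `X` that separates points of `X` satisfying `B` from the others. -/
def Good (X : Finset Pt) (B : Pt → Prop) (l : Set Pt) : Prop :=
  ∃ a b c : ℝ, (a ≠ 0 ∨ b ≠ 0) ∧ l = {p : Pt | a * p.1 + b * p.2 = c} ∧
    (∀ x ∈ X, a * x.1 + b * x.2 ≠ c) ∧
    (∀ x ∈ X, ∀ y ∈ X, B x → ¬ B y →
      (a * x.1 + b * x.2 - c) * (a * y.1 + b * y.2 - c) < 0)

lemma good_infinite (X : Finset Pt) (B : Pt → Prop) (a b d : ℝ) (hab : a ≠ 0 ∨ b ≠ 0)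
    (h1 : ∀ x ∈ X, B x → a * x.1 + b * x.2 ≤ d) (h2 : ∀ x ∈ X, ¬ B x → d < a * x.1 + b * x.2) :
    {l | Good X B l}.Infinite := by
  classical
  obtain ⟨e, hde, he⟩ : ∃ e, d < e ∧ ∀ x ∈ X, ¬ B x → e ≤ a * x.1 + b * x.2 := by
    by_cases hne : (X.filter (fun x => ¬ B x)).Nonempty
    · obtain ⟨z, hz, hz'⟩ := Finset.exists_min_image _ (fun x : Pt => a * x.1 + b * x.2) hne
      rw [Finset.mem_filter] at hz
      exact ⟨_, h2 z hz.1 hz.2, fun x hx hB => hz' x (Finset.mem_filter.2 ⟨hx, hB⟩)⟩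
    · refine ⟨d + 1, by linarith, fun x hx hB => absurd ⟨x, Finset.mem_filter.2 ⟨hx, hB⟩⟩ hne⟩
  have hinj : Function.Injective (fun c : ℝ => {p : Pt | a * p.1 + b * p.2 = c}) := by
    intro c c' hcc
    have hp : ∃ p : Pt, a * p.1 + b * p.2 = c := by
      rcases hab with h | h
      · exact ⟨(c / a, 0), by simp; field_simp⟩
      · exact ⟨(0, c / b), by simp; field_simp⟩
    obtain ⟨p, hp⟩ := hp
    have : p ∈ {p : Pt | a * p.1 + b * p.2 = c'} := by
      have hp' : p ∈ {p : Pt | a * p.1 + b * p.2 = c} := hp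
      rwa [show {p : Pt | a * p.1 + b * p.2 = c} = {p : Pt | a * p.1 + b * p.2 = c'} from hcc] at hp'
    exact hp.symm.trans this
  refine ((Set.Ioo_infinite hde).image hinj.injOn).mono ?_
  rintro _ ⟨c, ⟨hc1, hc2⟩, rfl⟩
  refine ⟨a, b, c, hab, rfl, ?_, ?_⟩
  · intro x hx
    by_cases hB : B x
    · exact (lt_of_le_of_lt (h1 x hx hB) hc1).ne
    · exact (lt_of_lt_of_le hc2 (he x hx hB)).ne'
  · intro x hx y hy hBx hBy
    have := h1 x hx hBx
    have := he y hy hBy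
    exact mul_neg_of_neg_of_pos (by linarith) (by linarith)

lemma good_infinite_or (X : Finset Pt) (q r : Pt) (hqr : q ≠ r) (B : Pt → Prop)
    (h1 : ∀ x ∈ X, B x → orr q r x ≤ 0) (h2 : ∀ x ∈ X, ¬ B x → 0 < orr q r x) :
    {l | Good X B l}.Infinite := by
  have e : ∀ x : Pt, orr q r x = (-(r.2 - q.2)) * x.1 + (r.1 - q.1) * x.2 -
      ((r.1 - q.1) * q.2 - (r.2 - q.2) * q.1) := by intro x; unfold orr; ring
  apply good_infinite X B (-(r.2 - q.2)) (r.1 - q.1) ((r.1 - q.1) * q.2 - (r.2 - q.2) * q.1)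
  · by_contra hcon
    push Not at hcon
    exact hqr (Prod.ext (by linarith [hcon.2]) (by linarith [hcon.1]))
  · intro x hx hB
    have := h1 x hx hB
    rw [e] at this; linarith
  · intro x hx hB
    have := h2 x hx hB
    rw [e] at this; linarith

lemma good_not (X : Finset Pt) (B : Pt → Prop) (l : Set Pt) (h : Good X (fun x => ¬ B x) l) :
    Good X B l := by
  obtain ⟨a, b, c, hab, hl, h1, h2⟩ := h
  refine ⟨a, b, c, hab, hl, h1, fun x hx y hy hBx hBy => ?_⟩
  rw [mul_comm]
  exact h2 y hy x hx hBy (not_not.2 hBx)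

lemma good_trivial (X : Finset Pt) (B : Pt → Prop) (h : ∀ x ∈ X, B x) :
    {l | Good X B l}.Infinite := by
  obtain ⟨d, hd⟩ := (X.finite_toSet.image (fun x : Pt => x.1)).bddAbove
  apply good_infinite X B 1 0 d (Or.inl one_ne_zero)
  · intro x hx _
    have := hd (Set.mem_image_of_mem _ hx)
    simpa using this
  · intro x hx hB
    exact absurd (h x hx) hB

lemma orr_self1 (p q : Pt) : orr p q p = 0 := by unfold orr; ring
lemma orr_self2 (p q : Pt) : orr p q q = 0 := by unfold orr; ring

lemma good_block (X : Finset Pt) (N : ℕ) (hN3 : 3 ≤ N) (p : ℕ → Pt)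
    (psurj : ∀ x ∈ X, ∃ t < N, p t = x)
    (ptri : ∀ i j k, i < j → j < k → k < N → 0 < orr (p i) (p j) (p k))
    (pinj : ∀ i < N, ∀ j < N, p i = p j → i = j) (i j : ℕ) :
    {l | Good X (fun x => ∃ t < N, i ≤ t ∧ t < j ∧ p t = x) l}.Infinite := by
  set B : Pt → Prop := fun x => ∃ t < N, i ≤ t ∧ t < j ∧ p t = x with hB
  have hBp : ∀ t < N, B (p t) ↔ (i ≤ t ∧ t < j) := by
    intro t ht
    constructor
    · rintro ⟨u, hu, h1, h2, h3⟩
      have := pinj u hu t ht h3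
      subst this; exact ⟨h1, h2⟩
    · rintro ⟨h1, h2⟩; exact ⟨t, ht, h1, h2, rfl⟩
  have neg : {l | Good X (fun x => ¬ B x) l}.Infinite → {l | Good X B l}.Infinite :=
    fun h => h.mono (fun l hl => good_not X B l hl)
  have ne : ∀ u v, u < N → v < N → u ≠ v → p u ≠ p v := fun u v hu hv h h' => h (pinj u hu v hv h')
  have hin : ∀ u v, u < v → v < N → ∀ t < N, u ≤ t → t ≤ v → orr (p u) (p v) (p t) ≤ 0 := by
    intro u v huv hv t ht h1 h2
    rcases h1.eq_or_lt with rfl | h1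
    · rw [orr_self1]
    rcases h2.eq_or_lt with rfl | h2
    · rw [orr_self2]
    have := ptri u t v h1 h2 hv
    have e : orr (p u) (p v) (p t) = - orr (p u) (p t) (p v) := by unfold orr; ring
    linarith
  have hout : ∀ u v, u < v → v < N → ∀ t < N, (t < u ∨ v < t) → 0 < orr (p u) (p v) (p t) := by
    intro u v huv hv t ht h
    rcases h with h | h
    · rw [← orr_cyc]; exact ptri t u v h huv hv
    · exact ptri u v t huv h ht
  by_cases hempty : ∀ t < N, ¬ (i ≤ t ∧ t < j)
  · apply neg
    apply good_trivial
    intro x hx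
    obtain ⟨t, ht, rfl⟩ := psurj x hx
    rw [hBp t ht]; exact hempty t ht
  push Not at hempty
  obtain ⟨t0, ht0, hi0, hj0⟩ := hempty
  obtain ⟨w, hw, hwj, hiw, hww⟩ : ∃ w, w < N ∧ w < j ∧ i ≤ w ∧ (∀ t < N, t < j ↔ t ≤ w) :=
    ⟨min (N - 1) (j - 1), by omega, by omega, by omega, by intro t ht; omega⟩
  rcases hiw.eq_or_lt with rfl | hiw
  ·
    have hBp' : ∀ t < N, B (p t) ↔ t = i := by
      intro t ht; rw [hBp t ht, hww t ht]; omega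
    rcases Nat.eq_zero_or_pos i with rfl | hpos
    · apply neg
      apply good_infinite_or X (p 1) (p (N - 1)) (ne _ _ (by omega) (by omega) (by omega))
      · intro x hx hb
        obtain ⟨t, ht, rfl⟩ := psurj x hx
        rw [hBp' t ht] at hb
        exact hin _ _ (by omega) (by omega) t ht (by omega) (by omega)
      · intro x hx hb
        obtain ⟨t, ht, rfl⟩ := psurj x hx
        rw [hBp' t ht] at hb
        exact hout _ _ (by omega) (by omega) t ht (by omega)
    by_cases hlast : i = N - 1
    · apply neg
      apply good_infinite_or X (p 0) (p (N - 2)) (ne _ _ (by omega) (by omega) (by omega))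
      · intro x hx hb
        obtain ⟨t, ht, rfl⟩ := psurj x hx
        rw [hBp' t ht] at hb
        exact hin _ _ (by omega) (by omega) t ht (by omega) (by omega)
      · intro x hx hb
        obtain ⟨t, ht, rfl⟩ := psurj x hx
        rw [hBp' t ht] at hb
        exact hout _ _ (by omega) (by omega) t ht (by omega)
    · apply neg
      apply good_infinite_or X (p (i + 1)) (p (i - 1)) (ne _ _ (by omega) (by omega) (by omega))
      · intro x hx hb
        obtain ⟨t, ht, rfl⟩ := psurj x hx
        rw [hBp' t ht] at hb
        rw [orr_swap]
        by_cases h1 : t = i - 1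
        · rw [h1, orr_self1]; simp
        by_cases h2 : t = i + 1
        · rw [h2, orr_self2]; simp
        have := hout (i - 1) (i + 1) (by omega) (by omega) t ht (by omega)
        linarith
      · intro x hx hb
        obtain ⟨t, ht, rfl⟩ := psurj x hx
        rw [hBp' t ht, not_not] at hb
        subst hb
        rw [orr_swap]
        have := ptri (t - 1) t (t + 1) (by omega) (by omega) (by omega)
        have e : orr (p (t - 1)) (p (t + 1)) (p t) = - orr (p (t - 1)) (p t) (p (t + 1)) := by
          unfold orr; ring
        linarith
  · apply good_infinite_or X (p i) (p w) (ne _ _ (by omega) (by omega) (by omega))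
    · intro x hx hb
      obtain ⟨t, ht, rfl⟩ := psurj x hx
      rw [hBp t ht, hww t ht] at hb
      exact hin _ _ (by omega) (by omega) t ht (by omega) (by omega)
    · intro x hx hb
      obtain ⟨t, ht, rfl⟩ := psurj x hx
      rw [hBp t ht, hww t ht] at hb
      exact hout _ _ (by omega) (by omega) t ht (by omega)

lemma choose_lines (G : ℕ → Set Pt → Prop) (h : ∀ i, {l | G i l}.Infinite) (K : ℕ) :
    ∃ L : Finset (Set Pt), L.card = K ∧ (∀ l ∈ L, ∃ i, G i l) ∧ ∀ i < K, ∃ l ∈ L, G i l := by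
  classical
  induction K with
  | zero => exact ⟨∅, by simp⟩
  | succ K ih =>
    obtain ⟨L, h1, h2, h3⟩ := ih
    obtain ⟨l, hl, hlL⟩ := (h K).exists_notMem_finset L
    refine ⟨insert l L, by rw [Finset.card_insert_of_notMem hlL, h1], ?_, ?_⟩
    · intro l' hl'
      rcases Finset.mem_insert.1 hl' with rfl | hl'
      · exact ⟨K, hl⟩
      · exact h2 l' hl'
    · intro i hi
      by_cases hiK : i = K
      · subst hiK; exact ⟨l, Finset.mem_insert_self _ _, hl⟩
      · obtain ⟨l', hl', hG⟩ := h3 i (by omega)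
        exact ⟨l', Finset.mem_insert_of_mem hl', hG⟩

lemma sep_blocks (K m t u : ℕ) (hm : 1 ≤ m) (hu : u < 2 * K * m) (htu : t / m < u / m) :
    ∃ i < K, ¬ ((i * m ≤ t ∧ t < (i + K) * m) ↔ (i * m ≤ u ∧ u < (i + K) * m)) := by
  have hu' : u / m < 2 * K := (Nat.div_lt_iff_lt_mul hm).2 hu
  have key : ∀ i x, (i * m ≤ x ∧ x < (i + K) * m) ↔ (i ≤ x / m ∧ x / m < i + K) := by
    intro i x
    rw [Nat.le_div_iff_mul_le hm, Nat.div_lt_iff_lt_mul hm]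
  simp only [key]
  generalize t / m = a at *
  generalize u / m = b at *
  by_cases h : b < K
  · exact ⟨b, h, by omega⟩
  · by_cases h2 : b - K ≤ a
    · exact ⟨b - K, by omega, by omega⟩
    · exact ⟨a, by omega, by omega⟩

lemma part_two (X : Finset Pt) (N : ℕ) (hN : X.card = N) (hN3 : 3 ≤ N)
    (hgp : GenPos ↑X) (hcp : ConvexPos ↑X) (K : ℕ) (hK : 1 ≤ K) :
    ∃ L : Finset (Set Pt), L.card = K ∧
        (∀ l ∈ L, IsAffLine l ∧ Disjoint l (↑X : Set Pt)) ∧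
        ∀ cell, IsCell ↑L cell →
          ((((↑X : Set Pt) ∩ cell).ncard : ℤ)) ≤ ⌈(N : ℝ) / (2 * K)⌉ := by
  classical
  obtain ⟨p, pX, psurj, ptri⟩ := exists_enum X N hN hN3 hgp hcp
  have pinj : ∀ i < N, ∀ j < N, p i = p j → i = j := by
    have : Set.InjOn p (Finset.range N) := by
      apply Finset.injOn_of_card_image_eq
      have : (Finset.range N).image p = X := by
        ext x
        simp only [Finset.mem_image, Finset.mem_range]
        constructor
        · rintro ⟨t, ht, rfl⟩; exact pX t ht
        · exact psurj x
      rw [this, hN, Finset.card_range]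
    intro i hi j hj h
    exact this (by simpa using hi) (by simpa using hj) h
  have hNK : (0 : ℝ) < (N : ℝ) / (2 * K) := by
    have : (0 : ℝ) < N := by exact_mod_cast (by omega : 0 < N)
    have : (0 : ℝ) < K := by exact_mod_cast hK
    positivity
  obtain ⟨m, hm⟩ : ∃ m : ℕ, ⌈(N : ℝ) / (2 * K)⌉ = m :=
    Int.eq_ofNat_of_zero_le (Int.ceil_pos.2 hNK).le
  have hm1 : 1 ≤ m := by
    have := Int.ceil_pos.2 hNK
    omega
  have hNm : N ≤ 2 * K * m := by
    have h := Int.le_ceil ((N : ℝ) / (2 * K))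
    rw [hm, div_le_iff₀ (by positivity)] at h
    have : (N : ℝ) ≤ ((2 * K * m : ℕ) : ℝ) := by push_cast at h ⊢; linarith
    exact_mod_cast this
  rw [hm]
  obtain ⟨L, hLc, hL1, hL2⟩ := choose_lines
    (fun i => Good X (fun x => ∃ t < N, i * m ≤ t ∧ t < (i + K) * m ∧ p t = x))
    (fun i => good_block X N hN3 p psurj ptri pinj (i * m) ((i + K) * m)) K
  refine ⟨L, hLc, ?_, ?_⟩
  · intro l hl
    obtain ⟨i, a, b, c, hab, hle, h1, _⟩ := hL1 l hl
    refine ⟨⟨a, b, c, hab, hle⟩, ?_⟩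
    rw [Set.disjoint_right]
    intro x hx hxl
    rw [hle] at hxl
    exact h1 x hx hxl
  · rintro cell ⟨q, hq, hcell⟩
    have hconn : IsPreconnected cell := by rw [hcell]; exact isPreconnected_connectedComponentIn
    have hsub : cell ⊆ (⋃₀ (↑L : Set (Set Pt)))ᶜ := by
      rw [hcell]; exact connectedComponentIn_subset _ _
    have nosep : ∀ i < K, ∀ x ∈ X, ∀ y ∈ X, x ∈ cell → y ∈ cell →
        (∃ t < N, i * m ≤ t ∧ t < (i + K) * m ∧ p t = x) →
        ¬ (∃ t < N, i * m ≤ t ∧ t < (i + K) * m ∧ p t = y) → False := by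
      intro i hi x hx y hy hxc hyc hBx hBy
      obtain ⟨l, hl, a, b, c, hab, hle, h1, h2⟩ := hL2 i hi
      have hneg := h2 x hx y hy hBx hBy
      have hcont : ContinuousOn (fun z : Pt => a * z.1 + b * z.2 - c) cell := by fun_prop
      have : ∃ z ∈ cell, a * z.1 + b * z.2 - c = 0 := by
        rcases mul_neg_iff.1 hneg with ⟨u, v⟩ | ⟨u, v⟩
        · exact hconn.intermediate_value hyc hxc hcont ⟨v.le, u.le⟩
        · exact hconn.intermediate_value hxc hyc hcont ⟨u.le, v.le⟩
      obtain ⟨z, hz, hz0⟩ := this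
      apply hsub hz
      refine ⟨l, hl, ?_⟩
      rw [hle]
      exact sub_eq_zero.1 hz0
    have hB : ∀ i t, t < N → ((∃ t' < N, i * m ≤ t' ∧ t' < (i + K) * m ∧ p t' = p t) ↔
        (i * m ≤ t ∧ t < (i + K) * m)) := by
      intro i t ht
      constructor
      · rintro ⟨u, hu, h1, h2, h3⟩
        have := pinj u hu t ht h3
        subst this; exact ⟨h1, h2⟩
      · rintro ⟨h1, h2⟩; exact ⟨t, ht, h1, h2, rfl⟩
    have hlt : ∀ t < N, ∀ u < N, p t ∈ cell → p u ∈ cell → ¬ (t / m < u / m) := by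
      intro t ht u hu htc huc hlt
      obtain ⟨i, hi, hsep⟩ := sep_blocks K m t u hm1 (by omega) hlt
      rw [← hB i t ht, ← hB i u hu] at hsep
      have A := nosep i hi (p t) (pX t ht) (p u) (pX u hu) htc huc
      have A' := nosep i hi (p u) (pX u hu) (p t) (pX t ht) huc htc
      exact hsep ⟨fun h => by_contra (A h), fun h => by_contra (A' h)⟩
    by_cases hne : ((↑X : Set Pt) ∩ cell).Nonempty
    · obtain ⟨x, hx, hxc⟩ := hne
      obtain ⟨t, ht, rfl⟩ := psurj x hx
      have hs : (↑X : Set Pt) ∩ cell ⊆ ↑((Finset.Ico (t / m * m) (t / m * m + m)).image p) := by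
        rintro y ⟨hy, hyc⟩
        obtain ⟨u, hu, rfl⟩ := psurj y hy
        have e : u / m = t / m := by
          have := hlt t ht u hu hxc hyc
          have := hlt u hu t ht hyc hxc
          omega
        simp only [Finset.coe_image]
        refine ⟨u, ?_, rfl⟩
        rw [Finset.coe_Ico, ← e]
        have h1 := Nat.div_add_mod' u m
        have h2 := Nat.mod_lt u hm1
        exact ⟨by omega, by omega⟩
      have h1 := Set.ncard_le_ncard hs (Finset.finite_toSet _)
      rw [Set.ncard_coe_finset] at h1
      have h2 : ((Finset.Ico (t / m * m) (t / m * m + m)).image p).card ≤ m :=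
        Finset.card_image_le.trans (by simp)
      exact_mod_cast h1.trans h2
    · rw [Set.not_nonempty_iff_eq_empty] at hne
      rw [hne]; simp

/-- Corollary 2.2.2. -/
theorem stmt_3 (X : Finset Pt) (N : ℕ) (hN : X.card = N) (hN3 : 3 ≤ N)
    (hgp : GenPos ↑X) (hcp : ConvexPos ↑X) (K : ℕ) (hK : 1 ≤ K) :
    (∀ L : Finset (Set Pt), L.card = K →
        (∀ l ∈ L, IsAffLine l ∧ Disjoint l (↑X : Set Pt)) →
        ∃ cell, IsCell ↑L cell ∧
          ⌈(N : ℝ) / (2 * K)⌉ ≤ ((((↑X : Set Pt) ∩ cell).ncard : ℤ))) ∧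
    (∃ L : Finset (Set Pt), L.card = K ∧
        (∀ l ∈ L, IsAffLine l ∧ Disjoint l (↑X : Set Pt)) ∧
        ∀ cell, IsCell ↑L cell →
          ((((↑X : Set Pt) ∩ cell).ncard : ℤ)) ≤ ⌈(N : ℝ) / (2 * K)⌉) := by
  exact ⟨fun L hL hLX => part_one X N hN hN3 hgp hcp K hK L hL hLX,
    part_two X N hN hN3 hgp hcp K hK⟩
end

section
/- There exists a constant C > 0 such that for every positive integer M there exists a set X ⊆ ℝ² of exactly M³ points in general position with the following two properties: X is contained in a Jordan curve with stabbing number at most 22, and every subset of X that is in convex position has cardinality at most C·M. -/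
open Set

/-- `S` is a union of at most `n` preconnected sets. -/
def Cov {α : Type} [TopologicalSpace α] (S : Set α) (n : ℕ) : Prop :=
  ∃ A : ℕ → Set α, (∀ i, IsPreconnected (A i)) ∧ ∀ x, x ∈ S ↔ ∃ i, i < n ∧ x ∈ A i

lemma Cov.union {α : Type} [TopologicalSpace α] {S T : Set α} {n m : ℕ}
    (hS : Cov S n) (hT : Cov T m) : Cov (S ∪ T) (n + m) := by
  obtain ⟨A, hA, hA'⟩ := hS
  obtain ⟨B, hB, hB'⟩ := hT
  refine ⟨fun i => if i < n then A i else B (i - n), ?_, ?_⟩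
  · intro i
    dsimp only
    split_ifs
    · exact hA i
    · exact hB _
  · intro x
    rw [Set.mem_union, hA', hB']
    constructor
    · rintro (⟨i, hi, hx⟩ | ⟨i, hi, hx⟩)
      · exact ⟨i, by omega, by simpa [hi] using hx⟩
      · exact ⟨n + i, by omega, by simpa using hx⟩
    · rintro ⟨i, hi, hx⟩
      by_cases h : i < n
      · exact Or.inl ⟨i, h, by simpa [h] using hx⟩
      · exact Or.inr ⟨i - n, by omega, by simpa [h] using hx⟩

lemma Cov.of_preconnected {α : Type} [TopologicalSpace α] {S : Set α} (h : IsPreconnected S) :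
    Cov S 1 :=
  ⟨fun _ => S, fun _ => h, fun x => ⟨fun hx => ⟨0, by omega, hx⟩, fun ⟨_, _, hx⟩ => hx⟩⟩

lemma Cov.empty {α : Type} [TopologicalSpace α] (n : ℕ) : Cov (∅ : Set α) n :=
  ⟨fun _ => ∅, fun _ => isPreconnected_empty, fun x => by simp⟩

lemma Cov.mono {α : Type} [TopologicalSpace α] {S : Set α} {n m : ℕ} (h : Cov S n) (hnm : n ≤ m) :
    Cov S m := by
  have := h.union (Cov.empty (α := α) (m - n))
  rwa [Set.union_empty, Nat.add_sub_cancel' hnm] at this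

lemma Cov.image {α β : Type} [TopologicalSpace α] [TopologicalSpace β] {S : Set α} {n : ℕ}
    (h : Cov S n) (f : α → β) (hf : Continuous f) : Cov (f '' S) n := by
  obtain ⟨A, hA, hA'⟩ := h
  refine ⟨fun i => f '' A i, fun i => (hA i).image f hf.continuousOn, fun y => ?_⟩
  constructor
  · rintro ⟨x, hx, rfl⟩
    obtain ⟨i, hi, hx⟩ := (hA' x).1 hx
    exact ⟨i, hi, x, hx, rfl⟩
  · rintro ⟨i, hi, x, hx, rfl⟩
    exact ⟨x, (hA' x).2 ⟨i, hi, hx⟩, rfl⟩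

lemma Cov.of_encard {α : Type} [TopologicalSpace α] (n : ℕ) : ∀ (S : Set α), S.encard ≤ n →
    Cov S n := by
  induction n with
  | zero =>
    intro S h
    have : S = ∅ := by simpa using h
    rw [this]; exact Cov.empty 0
  | succ n ih =>
    intro S h
    rcases S.eq_empty_or_nonempty with rfl | ⟨a, ha⟩
    · exact Cov.empty _
    · have h1 : (S \ {a}).encard ≤ n := by
        have := Set.encard_sdiff_singleton_add_one ha
        rw [← this] at h
        push_cast at h
        exact (ENat.add_le_add_iff_right ENat.one_ne_top).1 h
      have := (ih _ h1).union (Cov.of_preconnected (isPreconnected_singleton (x := a)))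
      have e : S \ {a} ∪ {a} = S := by
        rw [Set.sdiff_union_self]; exact Set.union_eq_left.2 (by simpa using ha)
      rwa [e] at this

lemma Cov.compsLE {S : Set Pt} {d : ℕ} (h : Cov S d) : CompsLE S d := by
  intro f hf
  obtain ⟨A, hA, hA'⟩ := h
  choose g hg hg' using fun i => (hA' (f i)).1 (hf i)
  have hsub : ∀ i, i < d → A i ⊆ S := fun i hi x hx => (hA' x).2 ⟨i, hi, hx⟩
  obtain ⟨i, j, hij, he⟩ := Fintype.exists_ne_map_eq_of_card_lt
    (fun i : Fin (d + 1) => (⟨g i, hg i⟩ : Fin d)) (by simp)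
  refine ⟨i, j, hij, ?_⟩
  have he' : g i = g j := by simpa using he
  have h1 := (hA (g i)).subset_connectedComponentIn (hg' i) (hsub _ (hg i))
  have h2 : f j ∈ connectedComponentIn S (f i) := h1 (he' ▸ hg' j)
  exact connectedComponentIn_eq h2

lemma graph_cov {G : ℝ → ℝ} (hG : Continuous G) {B : ℝ} {n : ℕ} (hn : 1 ≤ n)
    (h : ∀ α β : ℝ, Cov {x | x ∈ Icc 0 B ∧ G x = α * x + β} n) {l : Set Pt} (hl : IsAffLine l) :
    Cov ((fun x => ((x, G x) : Pt)) '' Icc 0 B ∩ l) n := by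
  obtain ⟨a, b, c, hab, rfl⟩ := hl
  by_cases hb : b = 0
  · subst hb
    have ha : a ≠ 0 := by simpa using hab
    refine (Cov.of_preconnected (Set.Subsingleton.isPreconnected ?_)).mono hn
    rintro _ ⟨⟨x, hx, rfl⟩, hx'⟩ _ ⟨⟨y, hy, rfl⟩, hy'⟩
    simp only [mem_ofPred_eq, zero_mul, add_zero] at hx' hy'
    have : x = y := mul_left_cancel₀ ha (hx'.trans hy'.symm)
    rw [this]
  · have := (h (-a / b) (c / b)).image (fun x => ((x, G x) : Pt)) (by fun_prop)
    convert this using 1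
    ext p
    constructor
    · rintro ⟨⟨x, hx, rfl⟩, hx'⟩
      refine ⟨x, ⟨hx, ?_⟩, rfl⟩
      simp only [mem_ofPred_eq] at hx'
      field_simp
      linarith
    · rintro ⟨x, ⟨hx, hx'⟩, rfl⟩
      refine ⟨⟨x, hx, rfl⟩, ?_⟩
      simp only [mem_ofPred_eq]
      rw [hx']
      field_simp
      ring

lemma jordan_of_graphs {f g : ℝ → ℝ} (hf : Continuous f) (hg : Continuous g) {B : ℝ} (hB : 0 < B)
    (h0 : f 0 = g 0) (h1 : f B = g B) (hlt : ∀ x, 0 < x → x < B → f x < g x) :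
    IsJordanCurve ((fun x => ((x, f x) : Pt)) '' Icc 0 B ∪ (fun x => ((x, g x) : Pt)) '' Icc 0 B) := by
  have hs : ∀ p : EuclideanSpace ℝ (Fin 2), p ∈ Metric.sphere (0 : EuclideanSpace ℝ (Fin 2)) 1 ↔
      p 0 ^ 2 + p 1 ^ 2 = 1 := by
    intro p
    rw [mem_sphere_zero_iff_norm, EuclideanSpace.norm_eq, Real.sqrt_eq_one]
    simp [Fin.sum_univ_two]
  let X : EuclideanSpace ℝ (Fin 2) → ℝ := fun p => B / 2 * (1 + p 0)
  have hXc : Continuous X := by fun_prop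
  have hp1 : Continuous fun p : EuclideanSpace ℝ (Fin 2) => p 1 := by fun_prop
  have hXI : ∀ p ∈ Metric.sphere (0 : EuclideanSpace ℝ (Fin 2)) 1, X p ∈ Icc 0 B := by
    intro p hp
    rw [hs] at hp
    have a1 : -1 ≤ p 0 := by nlinarith [sq_nonneg (p 1)]
    have a2 : p 0 ≤ 1 := by nlinarith [sq_nonneg (p 1)]
    constructor <;> simp only [X] <;> nlinarith
  have hfg : ∀ x ∈ Icc 0 B, f x = g x → x = 0 ∨ x = B := by
    intro x hx he
    by_contra hne
    push Not at hne
    have := hlt x (lt_of_le_of_ne hx.1 (Ne.symm hne.1)) (lt_of_le_of_ne hx.2 hne.2)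
    linarith
  refine ⟨fun p => (X p, if p 1 ≤ 0 then f (X p) else g (X p)), ?_, ?_, ?_⟩
  · refine ContinuousOn.prodMk hXc.continuousOn ?_
    refine ContinuousOn.if ?_ (hf.comp hXc).continuousOn (hg.comp hXc).continuousOn
    rintro p ⟨hp, hfr⟩
    have hz : p 1 = 0 := frontier_le_subset_eq hp1 continuous_const hfr
    rw [hs, hz] at hp
    have : p 0 = 1 ∨ p 0 = -1 := by
      have hm : (p 0 - 1) * (p 0 + 1) = 0 := by linarith
      rcases mul_eq_zero.1 hm with h | h
      · exact Or.inl (by linarith)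
      · exact Or.inr (by linarith)
    rcases this with h | h
    · have : X p = B := by simp only [X, h]; ring
      rw [this, h1]
    · have : X p = 0 := by simp only [X, h]; ring
      rw [this, h0]
  · intro p hp q hq he
    have e1 : X p = X q := congrArg Prod.fst he
    have e2 := congrArg Prod.snd he
    simp only at e2
    have e0 : p 0 = q 0 := by
      have : B / 2 ≠ 0 := by positivity
      simp only [X] at e1
      have := mul_left_cancel₀ this e1
      linarith
    have hI := hXI p hp
    have hp' := (hs p).1 hp
    have hq' := (hs q).1 hq
    have hzero : f (X p) = g (X p) → p 1 = 0 ∧ q 1 = 0 := by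
      intro h
      have : p 0 ^ 2 = 1 := by
        rcases hfg _ hI h with h | h
        · have : p 0 = -1 := by simp only [X] at h; nlinarith
          rw [this]; norm_num
        · have : p 0 = 1 := by simp only [X] at h; nlinarith
          rw [this]; norm_num
      rw [← e0] at hq'
      exact ⟨by nlinarith, by nlinarith⟩
    have e3 : p 1 = q 1 := by
      rw [← e1] at e2
      split_ifs at e2 with a b b
      · rw [e0] at hp'
        nlinarith
      · rw [(hzero e2).1, (hzero e2).2]
      · rw [(hzero e2.symm).1, (hzero e2.symm).2]
      · rw [e0] at hp'
        nlinarith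
    ext i
    fin_cases i
    · exact e0
    · exact e3
  · ext ⟨x, y⟩
    have key : ∀ x ∈ Icc 0 B, 0 ≤ 1 - (2 * x / B - 1) ^ 2 := by
      intro x hx
      have a1 : 0 ≤ x / B := div_nonneg hx.1 hB.le
      have a2 : x / B ≤ 1 := (div_le_one hB).2 hx.2
      rw [mul_div_assoc]
      nlinarith
    constructor
    · rintro (⟨x, hx, he⟩ | ⟨x, hx, he⟩)
      · refine ⟨!₂[2 * x / B - 1, -√(1 - (2 * x / B - 1) ^ 2)], ?_, ?_⟩
        · rw [hs]; simp [Real.sq_sqrt (key x hx)]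
        · have : X !₂[2 * x / B - 1, -√(1 - (2 * x / B - 1) ^ 2)] = x := by
            simp only [X]; simp; field_simp
          simp only [this]
          rw [if_pos (by simp)]
          exact he
      · refine ⟨!₂[2 * x / B - 1, √(1 - (2 * x / B - 1) ^ 2)], ?_, ?_⟩
        · rw [hs]; simp [Real.sq_sqrt (key x hx)]
        · have hX : X !₂[2 * x / B - 1, √(1 - (2 * x / B - 1) ^ 2)] = x := by
            simp only [X]; simp; field_simp
          simp only [hX]
          rw [← he]
          split_ifs with h
          · have h' : 1 - (2 * x / B - 1) ^ 2 ≤ 0 := by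
              have h4 : √(1 - (2 * x / B - 1) ^ 2) ≤ 0 := by simpa using h
              exact Real.sqrt_eq_zero'.1 (le_antisymm h4 (Real.sqrt_nonneg _))
            have h2 : x * (B - x) = 0 := by
              have h3 : 1 - (2 * x / B - 1) ^ 2 = 0 := le_antisymm h' (key x hx)
              field_simp at h3
              nlinarith
            rcases mul_eq_zero.1 h2 with h | h
            · rw [h, h0]
            · rw [show x = B by linarith, h1]
          · rfl
    · rintro ⟨p, hp, he⟩
      have hI := hXI p hp
      simp only at he
      rw [← he]
      split_ifs
      · exact Or.inl ⟨X p, hI, rfl⟩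
      · exact Or.inr ⟨X p, hI, rfl⟩

/-- A Lipschitz graph can be closed up to a Jordan curve at the cost of two components. -/
lemma close_up {G : ℝ → ℝ} {B K : ℝ} (hB : 0 < B)
    (hL : ∀ x y, x ≤ y → |G y - G x| ≤ K * (y - x)) (hGc : Continuous G)
    (h : ∀ α β : ℝ, Cov {x | x ∈ Icc 0 B ∧ G x = α * x + β} 20) :
    ∃ J, IsJordanCurve J ∧ StabLE J 22 ∧ ∀ x ∈ Icc 0 B, ((x, G x) : Pt) ∈ J := by
  let g : ℝ → ℝ := fun x => min (G 0 + (K + 1) * x) (G B + (K + 1) * (B - x))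
  have hK := fun x y hxy => abs_le.1 (hL x y hxy)
  have hK0 : 0 ≤ K := by
    have := (abs_nonneg _).trans (hL 0 B hB.le)
    by_contra hk
    nlinarith
  have hgc : Continuous g := by fun_prop
  have hg : ∀ α β : ℝ, Cov {x | x ∈ Icc 0 B ∧ g x = α * x + β} 2 := by
    intro α β
    have e : {x | x ∈ Icc 0 B ∧ g x = α * x + β} =
        {x | 0 ≤ x ∧ x ≤ B ∧ G 0 + (K + 1) * x ≤ G B + (K + 1) * (B - x) ∧
          G 0 + (K + 1) * x = α * x + β} ∪
        {x | 0 ≤ x ∧ x ≤ B ∧ G B + (K + 1) * (B - x) ≤ G 0 + (K + 1) * x ∧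
          G B + (K + 1) * (B - x) = α * x + β} := by
      ext x
      simp only [mem_ofPred_eq, mem_Icc, mem_union, g]
      rcases le_total (G 0 + (K + 1) * x) (G B + (K + 1) * (B - x)) with h | h
      · rw [min_eq_left h]
        constructor
        · rintro ⟨⟨a, b⟩, c⟩
          exact Or.inl ⟨a, b, h, c⟩
        · rintro (⟨a, b, _, c⟩ | ⟨a, b, c, d⟩)
          · exact ⟨⟨a, b⟩, c⟩
          · exact ⟨⟨a, b⟩, by linarith⟩
      · rw [min_eq_right h]
        constructor
        · rintro ⟨⟨a, b⟩, c⟩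
          exact Or.inr ⟨a, b, h, c⟩
        · rintro (⟨a, b, c, d⟩ | ⟨a, b, _, c⟩)
          · exact ⟨⟨a, b⟩, by linarith⟩
          · exact ⟨⟨a, b⟩, c⟩
    rw [e]
    refine Cov.union (n := 1) (m := 1) (Cov.of_preconnected (Convex.isPreconnected ?_))
      (Cov.of_preconnected (Convex.isPreconnected ?_))
    · rintro x ⟨a1, a2, a3, a4⟩ y ⟨b1, b2, b3, b4⟩ s t hs ht hst
      obtain rfl : s = 1 - t := by linarith
      simp only [smul_eq_mul, mem_ofPred_eq]
      refine ⟨by positivity, ?_, ?_, ?_⟩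
      · nlinarith [mul_le_mul_of_nonneg_left a2 hs, mul_le_mul_of_nonneg_left b2 ht]
      · nlinarith [mul_le_mul_of_nonneg_left a3 hs, mul_le_mul_of_nonneg_left b3 ht]
      · linear_combination (1 - t) * a4 + t * b4
    · rintro x ⟨a1, a2, a3, a4⟩ y ⟨b1, b2, b3, b4⟩ s t hs ht hst
      obtain rfl : s = 1 - t := by linarith
      simp only [smul_eq_mul, mem_ofPred_eq]
      refine ⟨by positivity, ?_, ?_, ?_⟩
      · nlinarith [mul_le_mul_of_nonneg_left a2 hs, mul_le_mul_of_nonneg_left b2 ht]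
      · nlinarith [mul_le_mul_of_nonneg_left a3 hs, mul_le_mul_of_nonneg_left b3 ht]
      · linear_combination (1 - t) * a4 + t * b4
  refine ⟨_, jordan_of_graphs hGc hgc hB ?_ ?_ ?_, ?_, fun x hx => Or.inl ⟨x, hx, rfl⟩⟩
  · simp only [g]
    rw [min_eq_left] <;> [ring; nlinarith [hK 0 B hB.le]]
  · simp only [g]
    rw [min_eq_right] <;> [ring; nlinarith [hK 0 B hB.le]]
  · intro x hx hx'
    simp only [g]
    refine lt_min ?_ ?_
    · nlinarith [hK 0 x hx.le]
    · nlinarith [hK x B hx'.le]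
  · intro l hl
    rw [Set.union_inter_distrib_right]
    exact ((graph_cov hGc (by norm_num) h hl).union (graph_cov hgc (by norm_num) hg hl)).compsLE

/-- Tent function. -/
noncomputable def tent (L x : ℝ) : ℝ := max 0 (min (L * x) ((1 - x) / 8))

/-- Sawtooth. -/
noncomputable def saw (M : ℕ) (x : ℝ) : ℝ := ∑ j ∈ Finset.range M, tent (2 * M + 1) (x - j)

/-- The inner two-level function. -/
noncomputable def inn (M : ℕ) (x : ℝ) : ℝ := -x ^ 2 + saw M x

/-- Lipschitz bound of the inner function. -/
noncomputable def lam (M : ℕ) : ℝ := 2 * M + M * (2 * M + 1)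

/-- Clamping to `[0, M]`. -/
noncomputable def clm (M : ℕ) (x : ℝ) : ℝ := max 0 (min x M)

/-- One outer hinge. -/
noncomputable def psi (M : ℕ) (x : ℝ) : ℝ :=
  2 * lam M * clm M x + inn M (clm M x) + 4 * lam M * max 0 (x - M)

/-- The whole curve. -/
noncomputable def crv (M : ℕ) (x : ℝ) : ℝ := ∑ i ∈ Finset.range M, psi M (x - 4 * M * i)

lemma tent_nonneg (L x : ℝ) : 0 ≤ tent L x := le_max_left _ _

lemma tent_of_nonpos {L x : ℝ} (hL : 0 ≤ L) (hx : x ≤ 0) : tent L x = 0 := by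
  unfold tent
  refine max_eq_left ((min_le_left _ _).trans ?_)
  exact mul_nonpos_of_nonneg_of_nonpos hL hx

lemma tent_of_one_le {L x : ℝ} (hx : 1 ≤ x) : tent L x = 0 := by
  unfold tent
  exact max_eq_left ((min_le_right _ _).trans (by linarith))

lemma tent_of_mem {L x : ℝ} (hL : 0 ≤ L) (hx : 0 ≤ x) (hx1 : x ≤ 1) :
    tent L x = min (L * x) ((1 - x) / 8) := by
  unfold tent
  exact max_eq_right (le_min (by positivity) (by linarith))

lemma tent_le {L x : ℝ} (hL : 0 ≤ L) : tent L x ≤ 1 / 8 := by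
  rcases le_total x 0 with h | h
  · rw [tent_of_nonpos hL h]; norm_num
  · exact max_le (by norm_num) ((min_le_right _ _).trans (by linarith))

lemma tent_lip {L : ℝ} (hL : 1 ≤ L) {x y : ℝ} (hxy : x ≤ y) :
    |tent L y - tent L x| ≤ L * (y - x) := by
  unfold tent
  refine (abs_max_sub_max_le_max _ _ _ _).trans (max_le (by simp; nlinarith) ?_)
  refine (abs_min_sub_min_le_max _ _ _ _).trans (max_le ?_ ?_)
  · rw [← mul_sub, abs_of_nonneg (by nlinarith)]
  · rw [abs_le]; constructor <;> nlinarith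

lemma saw_lip (M : ℕ) {x y : ℝ} (hxy : x ≤ y) :
    |saw M y - saw M x| ≤ M * (2 * M + 1) * (y - x) := by
  unfold saw
  rw [← Finset.sum_sub_distrib]
  refine (Finset.abs_sum_le_sum_abs _ _).trans ?_
  calc _ ≤ ∑ j ∈ Finset.range M, (2 * (M : ℝ) + 1) * (y - x) := by
        refine Finset.sum_le_sum fun j _ => ?_
        refine (tent_lip (by linarith [(Nat.cast_nonneg M : (0 : ℝ) ≤ M)])
          (by linarith : x - (j : ℝ) ≤ y - j)).trans (le_of_eq (by ring))
    _ = _ := by simp; ring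

lemma saw_eq (M : ℕ) {x : ℝ} {k : ℤ} (hx0 : 0 ≤ x) (hxM : x ≤ M) (hk : (k : ℝ) ≤ x)
    (hk1 : x < k + 1) : saw M x = tent (2 * M + 1) (x - k) := by
  have hL : (0 : ℝ) ≤ 2 * M + 1 := by positivity
  have hk0 : 0 ≤ k := by
    have : (-1 : ℝ) < k := by linarith
    have : (-1 : ℤ) < k := by exact_mod_cast this
    omega
  obtain ⟨n, rfl⟩ := Int.eq_ofNat_of_zero_le hk0
  simp only [Int.cast_natCast] at *
  have hother : ∀ j : ℕ, j ≠ n → tent (2 * M + 1) (x - j) = 0 := by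
    intro j hj
    rcases lt_or_gt_of_ne hj with h | h
    · have : (j : ℝ) + 1 ≤ n := by exact_mod_cast h
      exact tent_of_one_le (by linarith)
    · have : (n : ℝ) + 1 ≤ j := by exact_mod_cast h
      exact tent_of_nonpos hL (by linarith)
  unfold saw
  by_cases hn : n < M
  · exact Finset.sum_eq_single n (fun j _ hj => hother j hj) (fun h => absurd (Finset.mem_range.2 hn) h)
  · have : (M : ℝ) ≤ n := by exact_mod_cast not_lt.1 hn
    rw [tent_of_nonpos hL (by linarith)]
    exact Finset.sum_eq_zero fun j hj => hother j (by have := Finset.mem_range.1 hj; omega)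

lemma saw_bds (M : ℕ) {x : ℝ} (hx0 : 0 ≤ x) (hxM : x ≤ M) : 0 ≤ saw M x ∧ saw M x ≤ 1 / 8 := by
  rw [saw_eq M hx0 hxM (Int.floor_le x) (Int.lt_floor_add_one x)]
  exact ⟨tent_nonneg _ _, tent_le (by positivity)⟩

lemma inn_lip (M : ℕ) {x y : ℝ} (hx : 0 ≤ x) (hxy : x ≤ y) (hy : y ≤ M) :
    |inn M y - inn M x| ≤ lam M * (y - x) := by
  have h := abs_le.1 (saw_lip M hxy)
  unfold inn lam
  rw [abs_le]
  constructor <;> nlinarith [h.1, h.2, mul_nonneg (sub_nonneg.2 hxy) (by linarith : 0 ≤ x + y),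
    mul_nonneg (sub_nonneg.2 hxy) (by linarith : 0 ≤ 2 * M - x - y)]

lemma inn_zero (M : ℕ) : inn M 0 = 0 := by
  unfold inn saw
  rw [Finset.sum_eq_zero]
  · simp
  · intro j _
    exact tent_of_nonpos (by positivity) (by simp)

lemma lam_pos {M : ℕ} (hM : 0 < M) : 0 < lam M := by
  unfold lam; positivity

lemma quad_roots (p q : ℝ) : {x : ℝ | x ^ 2 = p * x + q}.encard ≤ 2 := by
  rcases Set.eq_empty_or_nonempty {x : ℝ | x ^ 2 = p * x + q} with h | ⟨r, hr⟩
  · rw [h]; simp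
  · have h2 : ({r, p - r} : Set ℝ).encard ≤ 2 := by
      refine (Set.encard_insert_le _ _).trans ?_
      rw [Set.encard_singleton]; norm_num
    refine (Set.encard_le_encard (t := {r, p - r}) ?_).trans h2
    intro x hx
    simp only [mem_ofPred_eq] at hx hr
    have : (x - r) * (x - (p - r)) = 0 := by linear_combination hx - hr
    rcases mul_eq_zero.1 this with h | h
    · left; linarith
    · right; simp; linarith

lemma block_card (M : ℕ) (k : ℤ) (α β : ℝ) :
    {x : ℝ | 0 ≤ x ∧ x ≤ M ∧ (k : ℝ) ≤ x ∧ x < k + 1 ∧ inn M x = α * x + β}.encard ≤ 4 := by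
  have hs : {x : ℝ | 0 ≤ x ∧ x ≤ M ∧ (k : ℝ) ≤ x ∧ x < k + 1 ∧ inn M x = α * x + β} ⊆
      {x : ℝ | x ^ 2 = (2 * M + 1 - α) * x + (-(2 * M + 1) * k - β)} ∪
      {x : ℝ | x ^ 2 = (-1 / 8 - α) * x + ((1 + k) / 8 - β)} := by
    rintro x ⟨h0, h1, h2, h3, h4⟩
    unfold inn at h4
    rw [saw_eq M h0 h1 h2 h3, tent_of_mem (by positivity) (by linarith) (by linarith)] at h4
    rcases min_choice ((2 * (M : ℝ) + 1) * (x - k)) ((1 - (x - k)) / 8) with h | h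
    · left
      rw [h] at h4
      simp only [mem_ofPred_eq]
      linarith
    · right
      rw [h] at h4
      simp only [mem_ofPred_eq]
      linarith
  refine (Set.encard_le_encard hs).trans ((Set.encard_union_le _ _).trans ?_)
  refine (add_le_add (quad_roots _ _) (quad_roots _ _)).trans ?_
  norm_num

/-- Zeros within a window of length one. -/
lemma window_card (M : ℕ) (α β : ℝ) (S : Set ℝ)
    (hS : ∀ x ∈ S, 0 ≤ x ∧ x ≤ M ∧ inn M x = α * x + β)
    (hw : ∀ x ∈ S, ∀ y ∈ S, |x - y| ≤ 1 / 2) : S.encard ≤ 8 := by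
  rcases S.eq_empty_or_nonempty with rfl | ⟨z, hz⟩
  · simp
  · set k := ⌊z - 1 / 2⌋ with hk
    have k1 := Int.floor_le (z - 1 / 2)
    have k2 := Int.lt_floor_add_one (z - 1 / 2)
    rw [← hk] at k1 k2
    have hs : S ⊆ {x : ℝ | 0 ≤ x ∧ x ≤ M ∧ (k : ℝ) ≤ x ∧ x < k + 1 ∧ inn M x = α * x + β} ∪
        {x : ℝ | 0 ≤ x ∧ x ≤ M ∧ ((k + 1 : ℤ) : ℝ) ≤ x ∧ x < (k + 1 : ℤ) + 1 ∧
          inn M x = α * x + β} := by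
      intro x hx
      obtain ⟨a, b, c⟩ := hS x hx
      have := abs_le.1 (hw x hx z hz)
      push_cast
      by_cases h : x < k + 1
      · exact Or.inl ⟨a, b, by linarith, h, c⟩
      · exact Or.inr ⟨a, b, by linarith, by linarith, c⟩
    refine (Set.encard_le_encard hs).trans ((Set.encard_union_le _ _).trans ?_)
    refine (add_le_add (block_card M k α β) (block_card M (k + 1) α β)).trans ?_
    norm_num

lemma inn_card (M : ℕ) (α β : ℝ) :
    {x : ℝ | 0 ≤ x ∧ x ≤ M ∧ inn M x = α * x + β}.encard ≤ 16 := by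
  have hs : {x : ℝ | 0 ≤ x ∧ x ≤ M ∧ inn M x = α * x + β} ⊆
      {x : ℝ | 0 ≤ x ∧ x ≤ M ∧ inn M x = α * x + β ∧ x ≤ -α / 2} ∪
      {x : ℝ | 0 ≤ x ∧ x ≤ M ∧ inn M x = α * x + β ∧ -α / 2 ≤ x} := by
    rintro x ⟨a, b, c⟩
    rcases le_total x (-α / 2) with h | h
    · exact Or.inl ⟨a, b, c, h⟩
    · exact Or.inr ⟨a, b, c, h⟩
  have key : ∀ x y : ℝ, 0 ≤ x ∧ x ≤ M ∧ inn M x = α * x + β →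
      0 ≤ y ∧ y ≤ M ∧ inn M y = α * y + β → (x + α / 2) ^ 2 - (y + α / 2) ^ 2 ≤ 1 / 4 := by
    rintro x y ⟨a, b, c⟩ ⟨d, e, f⟩
    have h1 := saw_bds M a b
    have h2 := saw_bds M d e
    unfold inn at c f
    nlinarith
  refine (Set.encard_le_encard hs).trans ((Set.encard_union_le _ _).trans ?_)
  refine (add_le_add (window_card M α β _ ?_ ?_) (window_card M α β _ ?_ ?_)).trans ?_
  · rintro x ⟨a, b, c, d⟩; exact ⟨a, b, c⟩
  · rintro x ⟨a, b, c, d⟩ y ⟨a', b', c', d'⟩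
    have k1 := key x y ⟨a, b, c⟩ ⟨a', b', c'⟩
    have k2 := key y x ⟨a', b', c'⟩ ⟨a, b, c⟩
    have hsq : (x - y) ^ 2 ≤ (1 / 2 : ℝ) ^ 2 := by
      rcases le_total x y with h | h <;> nlinarith
    exact abs_le_of_sq_le_sq hsq (by norm_num)
  · rintro x ⟨a, b, c, d⟩; exact ⟨a, b, c⟩
  · rintro x ⟨a, b, c, d⟩ y ⟨a', b', c', d'⟩
    have k1 := key x y ⟨a, b, c⟩ ⟨a', b', c'⟩
    have k2 := key y x ⟨a', b', c'⟩ ⟨a, b, c⟩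
    have hsq : (x - y) ^ 2 ≤ (1 / 2 : ℝ) ^ 2 := by
      rcases le_total x y with h | h <;> nlinarith
    exact abs_le_of_sq_le_sq hsq (by norm_num)
  · norm_num

lemma psi_nonpos {M : ℕ} {x : ℝ} (hx : x ≤ 0) : psi M x = 0 := by
  have hM : (0 : ℝ) ≤ M := by positivity
  have h1 : clm M x = 0 := max_eq_left ((min_le_left _ _).trans hx)
  have h2 : max 0 (x - M) = 0 := max_eq_left (by linarith)
  unfold psi
  rw [h1, h2, inn_zero]; ring

lemma psi_mid {M : ℕ} {x : ℝ} (hx : 0 ≤ x) (hx' : x ≤ M) : psi M x = 2 * lam M * x + inn M x := by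
  have h1 : clm M x = x := by unfold clm; rw [min_eq_left hx', max_eq_right hx]
  have h2 : max 0 (x - M) = 0 := max_eq_left (by linarith)
  unfold psi
  rw [h1, h2]; ring

lemma psi_right {M : ℕ} {x y : ℝ} (hx : M ≤ x) (hy : M ≤ y) :
    psi M y - psi M x = 4 * lam M * (y - x) := by
  have hM : (0 : ℝ) ≤ M := by positivity
  have h1 : ∀ z : ℝ, M ≤ z → clm M z = M := fun z hz => by
    unfold clm; rw [min_eq_right hz, max_eq_right hM]
  have h2 : ∀ z : ℝ, M ≤ z → max 0 (z - M) = z - M := fun z hz => max_eq_right (by linarith)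
  unfold psi
  rw [h1 x hx, h1 y hy, h2 x hx, h2 y hy]; ring

lemma psi_slope {M : ℕ} (hM : 0 < M) {x y : ℝ} (hxy : x ≤ y) :
    0 ≤ psi M y - psi M x ∧ psi M y - psi M x ≤ 4 * lam M * (y - x) := by
  have hM0 : (0 : ℝ) ≤ M := by positivity
  have hl := lam_pos hM
  have a0 : ∀ z, 0 ≤ clm M z := fun z => le_max_left _ _
  have a1 : ∀ z, clm M z ≤ M := fun z => max_le hM0 (min_le_right _ _)
  have a2 : clm M x ≤ clm M y := max_le_max le_rfl (min_le_min hxy le_rfl)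
  have a3 : max 0 (x - M) ≤ max 0 (y - M) := max_le_max le_rfl (by linarith)
  have a4 : ∀ z, clm M z + max 0 (z - M) = max 0 z := by
    intro z
    unfold clm
    rcases le_total z M with h | h
    · rw [min_eq_left h, max_eq_left (by linarith : z - M ≤ 0), add_zero]
    · rw [min_eq_right h, max_eq_right hM0, max_eq_right (by linarith : 0 ≤ z - M),
        max_eq_right (by linarith)]; ring
  have a5 : max 0 y - max 0 x ≤ y - x := by
    rcases le_total x 0 with h | h
    · rw [max_eq_left h]
      rcases le_total y 0 with h' | h'
      · rw [max_eq_left h']; linarith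
      · rw [max_eq_right h']; linarith
    · rw [max_eq_right h, max_eq_right (h.trans hxy)]
  have a6 := abs_le.1 (inn_lip M (a0 x) a2 (a1 y))
  have b1 := a4 x
  have b2 := a4 y
  unfold psi
  have c1 : 0 ≤ lam M * (clm M y - clm M x) := mul_nonneg hl.le (by linarith)
  have c2 : 0 ≤ lam M * (max 0 (y - M) - max 0 (x - M)) := mul_nonneg hl.le (by linarith)
  have c3 : lam M * (clm M y - clm M x) + lam M * (max 0 (y - M) - max 0 (x - M)) ≤
      lam M * (y - x) := by
    rw [← mul_add]; exact mul_le_mul_of_nonneg_left (by linarith) hl.le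
  constructor <;> nlinarith

lemma sum_ite_range (M i : ℕ) (hi : i ≤ M) (c : ℝ) :
    ∑ j ∈ Finset.range M, (if j < i then c else 0) = i * c := by
  rw [← Finset.sum_filter]
  have : (Finset.range M).filter (fun j => j < i) = Finset.range i := by
    ext j; simp; omega
  rw [this]; simp

lemma crv_left {M : ℕ} (hM : 0 < M) {i : ℕ} (hi : i ≤ M) {x y : ℝ} (hxy : x ≤ y)
    (hy : y ≤ 4 * M * i) : crv M y - crv M x ≤ 4 * lam M * i * (y - x) := by
  unfold crv
  rw [← Finset.sum_sub_distrib]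
  calc _ ≤ ∑ j ∈ Finset.range M, (if j < i then 4 * lam M * (y - x) else 0) := by
        refine Finset.sum_le_sum fun j _ => ?_
        split_ifs with h
        · refine (psi_slope hM (by linarith : x - 4 * M * j ≤ y - 4 * M * j)).2.trans ?_
          exact le_of_eq (by ring)
        · have : (i : ℝ) ≤ j := by exact_mod_cast not_lt.1 h
          have : (4 * M : ℝ) * i ≤ 4 * M * j := by gcongr
          rw [psi_nonpos (by linarith), psi_nonpos (by linarith)]; simp
    _ = _ := by rw [sum_ite_range M i hi]; ring

lemma crv_right {M : ℕ} (hM : 0 < M) {i : ℕ} (hi : i < M) {x y : ℝ} (hxy : x ≤ y)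
    (hx : 4 * M * i + M ≤ x) : 4 * lam M * (i + 1) * (y - x) ≤ crv M y - crv M x := by
  unfold crv
  rw [← Finset.sum_sub_distrib]
  calc _ = ∑ j ∈ Finset.range M, (if j < i + 1 then 4 * lam M * (y - x) else 0) := by
        rw [sum_ite_range M (i + 1) hi]; push_cast; ring
    _ ≤ _ := by
        refine Finset.sum_le_sum fun j _ => ?_
        split_ifs with h
        · have : (j : ℝ) ≤ i := by exact_mod_cast (Nat.lt_succ_iff.1 h)
          have : (4 * M : ℝ) * j ≤ 4 * M * i := by gcongr
          rw [psi_right (by linarith) (by linarith)]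
          exact le_of_eq (by ring)
        · exact (psi_slope hM (by linarith : x - 4 * M * j ≤ y - 4 * M * j)).1

lemma crv_mid {M : ℕ} (hM : 0 < M) {i : ℕ} (hi : i < M) {u v : ℝ} (hu : 0 ≤ u) (hu' : u ≤ M)
    (hv : 0 ≤ v) (hv' : v ≤ M) :
    crv M (4 * M * i + v) - crv M (4 * M * i + u) =
      (4 * lam M * i + 2 * lam M) * (v - u) + (inn M v - inn M u) := by
  have hM1 : (0 : ℝ) < M := by exact_mod_cast hM
  unfold crv
  rw [← Finset.sum_sub_distrib]
  calc _ = ∑ j ∈ Finset.range M, ((if j < i then 4 * lam M * (v - u) else 0) +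
          (if j = i then 2 * lam M * (v - u) + (inn M v - inn M u) else 0)) := by
        refine Finset.sum_congr rfl fun j _ => ?_
        rcases lt_trichotomy j i with h | h | h
        · have h1 : (j : ℝ) + 1 ≤ i := by exact_mod_cast h
          have h2 : (4 * M : ℝ) * (j + 1) ≤ 4 * M * i := by gcongr
          rw [psi_right (by linarith) (by linarith), if_pos h, if_neg h.ne]
          ring
        · subst h
          rw [if_neg (lt_irrefl _), if_pos rfl, add_sub_cancel_left, add_sub_cancel_left,
            psi_mid hu hu', psi_mid hv hv']
          ring
        · have h1 : (i : ℝ) + 1 ≤ j := by exact_mod_cast h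
          have h2 : (4 * M : ℝ) * (i + 1) ≤ 4 * M * j := by gcongr
          rw [psi_nonpos (by linarith), psi_nonpos (by linarith), if_neg (by omega),
            if_neg (by omega)]
          simp
    _ = _ := by
        rw [Finset.sum_add_distrib, sum_ite_range M i hi.le, Finset.sum_ite_eq']
        rw [if_pos (Finset.mem_range.2 hi)]
        ring

lemma crv_lip {M : ℕ} (hM : 0 < M) {x y : ℝ} (hxy : x ≤ y) :
    0 ≤ crv M y - crv M x ∧ crv M y - crv M x ≤ 4 * lam M * M * (y - x) := by
  unfold crv
  rw [← Finset.sum_sub_distrib]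
  constructor
  · exact Finset.sum_nonneg fun j _ =>
      (psi_slope hM (by linarith : x - 4 * M * j ≤ y - 4 * M * j)).1
  · calc _ ≤ ∑ j ∈ Finset.range M, 4 * lam M * (y - x) := by
          refine Finset.sum_le_sum fun j _ => ?_
          refine (psi_slope hM (by linarith : x - 4 * M * j ≤ y - 4 * M * j)).2.trans ?_
          exact le_of_eq (by ring)
      _ = _ := by simp; ring

lemma crv_cont {M : ℕ} : Continuous (crv M) := by
  unfold crv psi inn saw clm tent
  fun_prop

lemma zero_mono {F : ℝ → ℝ} {I : Set ℝ} (hI : I.OrdConnected)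
    (h : ∀ x ∈ I, ∀ y ∈ I, x ≤ y → F x ≤ F y) : Cov {x | x ∈ I ∧ F x = 0} 1 := by
  refine Cov.of_preconnected (Set.OrdConnected.isPreconnected ⟨?_⟩)
  rintro x ⟨hx, hx'⟩ y ⟨hy, hy'⟩ z ⟨h1, h2⟩
  have hz : z ∈ I := hI.out hx hy ⟨h1, h2⟩
  have a := h x hx z hz h1
  have b := h z hz y hy h2
  exact ⟨hz, by linarith⟩

lemma crv_cov {M : ℕ} (hM : 0 < M) (B α β : ℝ) :
    Cov {x | x ∈ Icc 0 B ∧ crv M x = α * x + β} 20 := by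
  have hl := lam_pos hM
  rcases lt_or_ge α 0 with h | h0
  · have := zero_mono (F := fun x => crv M x - (α * x + β)) (I := Icc 0 B) ordConnected_Icc
      (fun x _ y _ hxy => by nlinarith [(crv_lip hM hxy).1])
    simp only [sub_eq_zero] at this
    exact this.mono (by norm_num)
  rcases le_or_gt (4 * lam M * M) α with h | h1
  · have := zero_mono (F := fun x => (α * x + β) - crv M x) (I := Icc 0 B) ordConnected_Icc
      (fun x _ y _ hxy => by nlinarith [(crv_lip hM hxy).2])
    simp only [sub_eq_zero, eq_comm (b := crv M _)] at this
    exact this.mono (by norm_num)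
  obtain ⟨i, hiM, hi1, hi2⟩ : ∃ i : ℕ, i < M ∧ 4 * lam M * i ≤ α ∧ α < 4 * lam M * (i + 1) := by
    have f1 := Nat.floor_le (div_nonneg h0 (by positivity : 0 ≤ 4 * lam M))
    have f2 := Nat.lt_floor_add_one (α / (4 * lam M))
    rw [le_div_iff₀ (by positivity)] at f1
    rw [div_lt_iff₀ (by positivity)] at f2
    refine ⟨⌊α / (4 * lam M)⌋₊, ?_, by linarith, by linarith⟩
    rw [Nat.floor_lt (div_nonneg h0 (by positivity)), div_lt_iff₀ (by positivity)]
    linarith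
  have A := zero_mono (F := fun x => (α * x + β) - crv M x) (I := Icc 0 B ∩ Iic (4 * M * i))
    (ordConnected_Icc.inter ordConnected_Iic)
    (fun x _ y hy hxy => by
      have := crv_left hM hiM.le hxy hy.2
      nlinarith [mul_le_mul_of_nonneg_right hi1 (sub_nonneg.2 hxy)])
  have C := zero_mono (F := fun x => crv M x - (α * x + β)) (I := Icc 0 B ∩ Ici (4 * M * i + M))
    (ordConnected_Icc.inter ordConnected_Ici)
    (fun x hx y _ hxy => by
      have := crv_right hM hiM hxy hx.2
      nlinarith [mul_le_mul_of_nonneg_right hi2.le (sub_nonneg.2 hxy)])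
  have D : Cov {x | x ∈ Icc 0 B ∧ (4 * M * i ≤ x ∧ x ≤ 4 * M * i + M) ∧ crv M x = α * x + β} 16 := by
    refine Cov.of_encard _ _ ?_
    refine le_trans (Set.encard_le_encard (t := (fun u : ℝ => 4 * M * i + u) ''
      {u : ℝ | 0 ≤ u ∧ u ≤ M ∧ inn M u = (α - (4 * lam M * i + 2 * lam M)) * u +
        (α * (4 * M * i) + β - crv M (4 * M * i))}) ?_) ?_
    · rintro x ⟨_, ⟨x1, x2⟩, x3⟩
      refine ⟨x - 4 * M * i, ⟨by linarith, by linarith, ?_⟩, by ring⟩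
      have := crv_mid hM hiM (u := 0) (v := x - 4 * M * i) le_rfl (by positivity) (by linarith)
        (by linarith)
      rw [inn_zero, add_zero, add_sub_cancel] at this
      linarith
    · exact (Set.encard_image_le _ _).trans (inn_card M _ _)
  have := (A.union D).union C
  refine Cov.mono (n := 1 + 16 + 1) ?_ (by norm_num)
  convert this using 1
  ext x
  simp only [mem_ofPred_eq, mem_union, mem_inter_iff, mem_Iic, mem_Ici, sub_eq_zero]
  constructor
  · rintro ⟨a, b⟩
    rcases le_total x (4 * M * i) with h | h
    · exact Or.inl (Or.inl ⟨⟨a, h⟩, b.symm⟩)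
    · rcases le_total x (4 * M * i + M) with h' | h'
      · exact Or.inl (Or.inr ⟨a, ⟨h, h'⟩, b⟩)
      · exact Or.inr ⟨⟨a, h'⟩, b⟩
  · rintro ((⟨⟨a, _⟩, b⟩ | ⟨a, _, b⟩) | ⟨⟨a, _⟩, b⟩)
    · exact ⟨a, b.symm⟩
    · exact ⟨a, b⟩
    · exact ⟨a, b⟩

/-- Strictly convex triple on the graph of `G`. -/
def Cup3 (G : ℝ → ℝ) (x y z : ℝ) : Prop := (G y - G x) * (z - y) < (G z - G y) * (y - x)

/-- Strictly concave triple on the graph of `G`. -/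
def Cap3 (G : ℝ → ℝ) (x y z : ℝ) : Prop := (G z - G y) * (y - x) < (G y - G x) * (z - y)

/-- Width of the innermost clusters. -/
noncomputable def wid (M : ℕ) : ℝ := 1 / (16 * (2 * M + 2))

/-- Position within an outer cluster. -/
noncomputable def ofs (M : ℕ) (j k : ℕ) : ℝ := j + wid M * k / M

/-- Abscissa of the point with the given index. -/
noncomputable def pos (M : ℕ) (t : ℕ × ℕ × ℕ) : ℝ := 4 * M * t.1 + ofs M t.2.1 t.2.2

lemma wid_pos (M : ℕ) : 0 < wid M := by unfold wid; positivity

lemma wid_bd (M : ℕ) : (2 * M + 1) * wid M ≤ 1 / 16 := by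
  unfold wid
  have : (0 : ℝ) ≤ M := by positivity
  rw [mul_one_div, div_le_div_iff₀ (by positivity) (by norm_num)]
  linarith

lemma wid_le (M : ℕ) : wid M ≤ 1 / 16 := by
  have := wid_bd M
  have h := wid_pos M
  have : (0 : ℝ) ≤ M := by positivity
  nlinarith

lemma ofs_bd {M : ℕ} (j : ℕ) {k : ℕ} (hk : k < M) : (j : ℝ) ≤ ofs M j k ∧ ofs M j k < j + wid M := by
  have hw := wid_pos M
  have hM : (0 : ℝ) < M := by exact_mod_cast (by omega : 0 < M)
  have hk' : (k : ℝ) < M := by exact_mod_cast hk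
  unfold ofs
  constructor
  · have : 0 ≤ wid M * k / M := by positivity
    linarith
  · have : wid M * k / M < wid M := by
      rw [div_lt_iff₀ hM]; nlinarith
    linarith

lemma ofs_range {M : ℕ} {j k : ℕ} (hj : j < M) (hk : k < M) : 0 ≤ ofs M j k ∧ ofs M j k ≤ M := by
  have h := ofs_bd j hk
  have h2 := wid_le M
  have h3 : (j : ℝ) + 1 ≤ M := by exact_mod_cast hj
  have h4 : (0 : ℝ) ≤ j := by positivity
  constructor <;> linarith

lemma inn_ofs {M : ℕ} {j k : ℕ} (hj : j < M) (hk : k < M) :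
    inn M (ofs M j k) = -(ofs M j k) ^ 2 + (2 * M + 1) * (ofs M j k - j) := by
  have h := ofs_bd j hk
  have h2 := wid_le M
  have h3 := ofs_range hj hk
  have h4 := wid_bd M
  have hM : (0 : ℝ) ≤ M := by positivity
  unfold inn
  rw [saw_eq M (k := (j : ℤ)) h3.1 h3.2 (by exact_mod_cast h.1)
    (by push_cast; linarith)]
  push_cast
  rw [tent_of_mem (by positivity) (by linarith) (by linarith), min_eq_left]
  have : (2 * M + 1) * (ofs M j k - j) ≤ (2 * M + 1) * wid M := by
    gcongr; linarith
  linarith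

/-- Same innermost cluster: the inner function increases with slope exactly `L - (u + v)`. -/
lemma inn_diff_same {M : ℕ} {j k k' : ℕ} (hj : j < M) (hk : k < M) (hk' : k' < M) :
    inn M (ofs M j k') - inn M (ofs M j k) =
      (2 * M + 1 - (ofs M j k + ofs M j k')) * (ofs M j k' - ofs M j k) := by
  rw [inn_ofs hj hk, inn_ofs hj hk']; ring

lemma inn_incr {M : ℕ} {j k k' : ℕ} (hj : j < M) (hk : k < M) (hk' : k' < M)
    (h : ofs M j k < ofs M j k') : 0 < inn M (ofs M j k') - inn M (ofs M j k) := by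
  rw [inn_diff_same hj hk hk']
  have h1 := ofs_range hj hk
  have h2 := ofs_range hj hk'
  exact mul_pos (by linarith) (by linarith)

/-- Different innermost clusters: the slope is about `-(u + v)`. -/
lemma inn_diff_ne {M : ℕ} {j j' k k' : ℕ} (hjj : j < j') (hj' : j' < M) (hk : k < M)
    (hk' : k' < M) : ∃ s : ℝ, inn M (ofs M j' k') - inn M (ofs M j k) =
      s * (ofs M j' k' - ofs M j k) ∧ |s + (ofs M j k + ofs M j' k')| ≤ 1 / 8 ∧
      7 / 8 ≤ ofs M j' k' - ofs M j k := by
  have hj : j < M := hjj.trans hj'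
  have h1 := ofs_bd j hk
  have h2 := ofs_bd j' hk'
  have h3 := wid_le M
  have h4 := wid_bd M
  have h5 : (j : ℝ) + 1 ≤ j' := by exact_mod_cast hjj
  have hM : (0 : ℝ) ≤ M := by positivity
  have hd : 7 / 8 ≤ ofs M j' k' - ofs M j k := by linarith
  have e1 : (2 * M + 1) * (ofs M j k - j) ≤ (2 * M + 1) * wid M := by gcongr; linarith
  have e2 : (2 * M + 1) * (ofs M j' k' - j') ≤ (2 * M + 1) * wid M := by gcongr; linarith
  have e3 : 0 ≤ (2 * M + 1) * (ofs M j k - j) := mul_nonneg (by positivity) (by linarith)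
  have e4 : 0 ≤ (2 * M + 1) * (ofs M j' k' - j') := mul_nonneg (by positivity) (by linarith)
  have hne : ofs M j' k' - ofs M j k ≠ 0 := by linarith
  refine ⟨(inn M (ofs M j' k') - inn M (ofs M j k)) / (ofs M j' k' - ofs M j k), ?_, ?_, hd⟩
  · field_simp
  · have : (inn M (ofs M j' k') - inn M (ofs M j k)) / (ofs M j' k' - ofs M j k) +
        (ofs M j k + ofs M j' k') = ((2 * M + 1) * (ofs M j' k' - j') -
          (2 * M + 1) * (ofs M j k - j)) / (ofs M j' k' - ofs M j k) := by
      rw [inn_ofs hj hk, inn_ofs hj' hk']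
      rw [eq_div_iff hne, add_mul, div_mul_cancel₀ _ hne]
      ring
    rw [this, abs_div, abs_of_pos (by linarith : 0 < ofs M j' k' - ofs M j k),
      div_le_iff₀ (by linarith), abs_le]
    constructor <;> linarith

lemma inn_ori_cap {M : ℕ} {j₁ j₂ j₃ k₁ k₂ k₃ : ℕ} (h3 : j₃ < M)
    (hk₁ : k₁ < M) (hk₂ : k₂ < M) (hk₃ : k₃ < M) (h12 : j₁ ≤ j₂) (h23 : j₂ ≤ j₃)
    (huv : ofs M j₁ k₁ < ofs M j₂ k₂) (hvw : ofs M j₂ k₂ < ofs M j₃ k₃)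
    (hn : ¬ (j₁ < j₂ ∧ j₂ = j₃)) :
    Cap3 (inn M) (ofs M j₁ k₁) (ofs M j₂ k₂) (ofs M j₃ k₃) := by
  unfold Cap3
  rcases h12.eq_or_lt with rfl | h12
  · rcases h23.eq_or_lt with rfl | h23
    · rw [inn_diff_same h3 hk₁ hk₂, inn_diff_same h3 hk₂ hk₃]
      have := mul_pos (mul_pos (sub_pos.2 huv) (sub_pos.2 hvw)) (sub_pos.2 (huv.trans hvw))
      nlinarith
    · have a := inn_incr (h23.trans h3) hk₁ hk₂ huv
      obtain ⟨s, hs, hs', hd⟩ := inn_diff_ne h23 h3 hk₂ hk₃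
      have hs' := abs_le.1 hs'
      have b := (ofs_range (h23.trans h3) hk₂).1
      rw [hs]
      have c : s < 0 := by linarith
      have d : s * (ofs M j₃ k₃ - ofs M j₁ k₂) < 0 := mul_neg_of_neg_of_pos c (by linarith)
      have e := mul_pos a (sub_pos.2 hvw)
      have f := mul_neg_of_neg_of_pos d (sub_pos.2 huv)
      linarith
  · have h23 : j₂ < j₃ := lt_of_le_of_ne h23 (fun h => hn ⟨h12, h⟩)
    obtain ⟨s, hs, hs', hd⟩ := inn_diff_ne h12 (h23.trans h3) hk₁ hk₂
    obtain ⟨t, ht, ht', he⟩ := inn_diff_ne h23 h3 hk₂ hk₃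
    have hs' := abs_le.1 hs'
    have ht' := abs_le.1 ht'
    rw [hs, ht]
    have : t < s := by linarith
    have := mul_pos (mul_pos (sub_pos.2 huv) (sub_pos.2 hvw)) (sub_pos.2 this)
    nlinarith

lemma inn_ori_cup {M : ℕ} {j₁ j₂ k₁ k₂ k₃ : ℕ} (h2 : j₂ < M)
    (hk₁ : k₁ < M) (hk₂ : k₂ < M) (hk₃ : k₃ < M) (h12 : j₁ < j₂)
    (huv : ofs M j₁ k₁ < ofs M j₂ k₂) (hvw : ofs M j₂ k₂ < ofs M j₂ k₃) :
    Cup3 (inn M) (ofs M j₁ k₁) (ofs M j₂ k₂) (ofs M j₂ k₃) := by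
  unfold Cup3
  have a := inn_incr h2 hk₂ hk₃ hvw
  obtain ⟨s, hs, hs', hd⟩ := inn_diff_ne h12 h2 hk₁ hk₂
  have hs' := abs_le.1 hs'
  have b := (ofs_range (h12.trans h2) hk₁).1
  rw [hs]
  have c : s < 0 := by linarith
  have d : s * (ofs M j₂ k₂ - ofs M j₁ k₁) < 0 := mul_neg_of_neg_of_pos c (by linarith)
  have e := mul_pos a (sub_pos.2 huv)
  have f := mul_neg_of_neg_of_pos d (sub_pos.2 hvw)
  linarith

/-- The index set. -/
def Idx (M : ℕ) : Finset (ℕ × ℕ × ℕ) :=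
  Finset.range M ×ˢ (Finset.range M ×ˢ Finset.range M)

lemma mem_Idx {M : ℕ} {t : ℕ × ℕ × ℕ} : t ∈ Idx M ↔ t.1 < M ∧ t.2.1 < M ∧ t.2.2 < M := by
  simp [Idx]

lemma pos_fst {M : ℕ} {s t : ℕ × ℕ × ℕ} (hs : s ∈ Idx M) (ht : t ∈ Idx M)
    (h : pos M s < pos M t) : s.1 ≤ t.1 := by
  rw [mem_Idx] at hs ht
  by_contra hc
  have h1 : (t.1 : ℝ) + 1 ≤ s.1 := by exact_mod_cast not_le.1 hc
  have h2 := ofs_range hs.2.1 hs.2.2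
  have h3 := ofs_range ht.2.1 ht.2.2
  have h4 : (4 * M : ℝ) * (t.1 + 1) ≤ 4 * M * s.1 := by gcongr
  have hM : (0 : ℝ) ≤ M := by positivity
  unfold pos at h
  linarith

lemma pos_snd {M : ℕ} {s t : ℕ × ℕ × ℕ} (hs : s ∈ Idx M) (ht : t ∈ Idx M)
    (h : pos M s < pos M t) (he : s.1 = t.1) :
    ofs M s.2.1 s.2.2 < ofs M t.2.1 t.2.2 ∧ s.2.1 ≤ t.2.1 := by
  rw [mem_Idx] at hs ht
  unfold pos at h
  rw [he] at h
  have h0 : ofs M s.2.1 s.2.2 < ofs M t.2.1 t.2.2 := by linarith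
  refine ⟨h0, ?_⟩
  by_contra hc
  have h1 : (t.2.1 : ℝ) + 1 ≤ s.2.1 := by exact_mod_cast not_le.1 hc
  have h2 := ofs_bd s.2.1 hs.2.2
  have h3 := ofs_bd t.2.1 ht.2.2
  have := wid_le M
  linarith

lemma pos_inj {M : ℕ} {s t : ℕ × ℕ × ℕ} (hs : s ∈ Idx M) (ht : t ∈ Idx M)
    (h : pos M s = pos M t) : s = t := by
  have hs' := mem_Idx.1 hs
  have ht' := mem_Idx.1 ht
  have hM : (0 : ℝ) < M := by exact_mod_cast (by omega : 0 < M)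
  have hw := wid_pos M
  have hw' := wid_le M
  have key1 : ∀ s ∈ Idx M, ∀ t ∈ Idx M, pos M s = pos M t → s.1 ≤ t.1 := by
    intro s hs t ht h
    rw [mem_Idx] at hs ht
    by_contra hc
    have h1 : (t.1 : ℝ) + 1 ≤ s.1 := by exact_mod_cast not_le.1 hc
    have h2 := ofs_range hs.2.1 hs.2.2
    have h3 := ofs_range ht.2.1 ht.2.2
    have h4 : (4 * M : ℝ) * (t.1 + 1) ≤ 4 * M * s.1 := by gcongr
    unfold pos at h
    linarith
  have e1 : s.1 = t.1 := le_antisymm (key1 s hs t ht h) (key1 t ht s hs h.symm)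
  have h0 : ofs M s.2.1 s.2.2 = ofs M t.2.1 t.2.2 := by
    unfold pos at h
    rw [e1] at h
    linarith
  have key2 : ∀ s ∈ Idx M, ∀ t ∈ Idx M, ofs M s.2.1 s.2.2 = ofs M t.2.1 t.2.2 → s.2.1 ≤ t.2.1 := by
    intro s hs t ht h
    rw [mem_Idx] at hs ht
    by_contra hc
    have h1 : (t.2.1 : ℝ) + 1 ≤ s.2.1 := by exact_mod_cast not_le.1 hc
    have h2 := ofs_bd s.2.1 hs.2.2
    have h3 := ofs_bd t.2.1 ht.2.2
    linarith
  have e2 : s.2.1 = t.2.1 := le_antisymm (key2 s hs t ht h0) (key2 t ht s hs h0.symm)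
  have e3 : s.2.2 = t.2.2 := by
    unfold ofs at h0
    rw [e2] at h0
    have h5 : wid M * s.2.2 / M = wid M * t.2.2 / M := by linarith
    rw [div_left_inj' hM.ne'] at h5
    exact_mod_cast mul_left_cancel₀ hw.ne' h5
  exact Prod.ext e1 (Prod.ext e2 e3)

lemma crv_ofs {M : ℕ} {s t : ℕ × ℕ × ℕ} (hs : s ∈ Idx M) (ht : t ∈ Idx M) (he : s.1 = t.1) :
    crv M (pos M t) - crv M (pos M s) = (4 * lam M * t.1 + 2 * lam M) * (pos M t - pos M s) +
      (inn M (ofs M t.2.1 t.2.2) - inn M (ofs M s.2.1 s.2.2)) := by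
  have hs' := mem_Idx.1 hs
  have ht' := mem_Idx.1 ht
  have h2 := ofs_range hs'.2.1 hs'.2.2
  have h3 := ofs_range ht'.2.1 ht'.2.2
  unfold pos
  rw [he, crv_mid (by omega) ht'.1 h2.1 h2.2 h3.1 h3.2]
  ring

lemma crv_cup_of {M : ℕ} {s t u : ℕ × ℕ × ℕ} (hs : s ∈ Idx M) (ht : t ∈ Idx M) (hu : u ∈ Idx M)
    (h1 : s.1 = t.1) (h2 : t.1 = u.1)
    (h : Cup3 (inn M) (ofs M s.2.1 s.2.2) (ofs M t.2.1 t.2.2) (ofs M u.2.1 u.2.2)) :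
    Cup3 (crv M) (pos M s) (pos M t) (pos M u) := by
  unfold Cup3 at *
  rw [crv_ofs hs ht h1, crv_ofs ht hu h2]
  unfold pos
  rw [h1, h2]
  linear_combination h

lemma crv_cap_of {M : ℕ} {s t u : ℕ × ℕ × ℕ} (hs : s ∈ Idx M) (ht : t ∈ Idx M) (hu : u ∈ Idx M)
    (h1 : s.1 = t.1) (h2 : t.1 = u.1)
    (h : Cap3 (inn M) (ofs M s.2.1 s.2.2) (ofs M t.2.1 t.2.2) (ofs M u.2.1 u.2.2)) :
    Cap3 (crv M) (pos M s) (pos M t) (pos M u) := by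
  unfold Cap3 at *
  rw [crv_ofs hs ht h1, crv_ofs ht hu h2]
  unfold pos
  rw [h1, h2]
  linear_combination h

/-- Slope bounds inside one outer cluster. -/
lemma crv_mid_bds {M : ℕ} (hM : 0 < M) {i : ℕ} (hi : i < M) {x y : ℝ} (hx : 4 * M * i ≤ x)
    (hxy : x ≤ y) (hy : y ≤ 4 * M * i + M) :
    (4 * lam M * i + lam M) * (y - x) ≤ crv M y - crv M x ∧
      crv M y - crv M x ≤ (4 * lam M * i + 3 * lam M) * (y - x) := by
  have h := crv_mid hM hi (u := x - 4 * M * i) (v := y - 4 * M * i) (by linarith) (by linarith)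
    (by linarith) (by linarith)
  have h2 := abs_le.1 (inn_lip M (x := x - 4 * M * i) (y := y - 4 * M * i) (by linarith)
    (by linarith) (by linarith))
  rw [add_sub_cancel, add_sub_cancel] at h
  rw [h]
  constructor <;> linarith

lemma slope_up {M : ℕ} {s t : ℕ × ℕ × ℕ} (hs : s ∈ Idx M) (ht : t ∈ Idx M) (h : s.1 < t.1) :
    crv M (pos M t) - crv M (pos M s) ≤ (4 * lam M * t.1 + 3 / 4 * lam M) * (pos M t - pos M s) ∧
    (4 * lam M * s.1 + 13 / 4 * lam M) * (pos M t - pos M s) ≤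
      crv M (pos M t) - crv M (pos M s) := by
  have hs' := mem_Idx.1 hs
  have ht' := mem_Idx.1 ht
  have hM : 0 < M := by omega
  have hM' : (0 : ℝ) < M := by exact_mod_cast hM
  have hl := lam_pos hM
  have a := ofs_range hs'.2.1 hs'.2.2
  have b := ofs_range ht'.2.1 ht'.2.2
  have h1 : (s.1 : ℝ) + 1 ≤ t.1 := by exact_mod_cast h
  have h4 : (4 * M : ℝ) * (s.1 + 1) ≤ 4 * M * t.1 := by gcongr
  set x := pos M s with hx
  set y := pos M t with hy
  have ex : x = 4 * M * s.1 + ofs M s.2.1 s.2.2 := rfl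
  have ey : y = 4 * M * t.1 + ofs M t.2.1 t.2.2 := rfl
  constructor
  · have c1 := crv_left hM ht'.1.le (x := x) (y := 4 * M * t.1) (by linarith) le_rfl
    have c2 := (crv_mid_bds hM ht'.1 (x := 4 * M * t.1) (y := y) le_rfl (by linarith)
      (by linarith)).2
    have c3 : lam M * (4 * (y - 4 * M * t.1)) ≤ lam M * (y - x) :=
      mul_le_mul_of_nonneg_left (by linarith) hl.le
    linarith
  · have c1 := crv_right hM hs'.1 (x := 4 * M * s.1 + M) (y := y) (by linarith) le_rfl
    have c2 := (crv_mid_bds hM hs'.1 (x := x) (y := 4 * M * s.1 + M) (by linarith) (by linarith)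
      le_rfl).1
    have c3 : lam M * (4 * (4 * M * s.1 + M - x)) ≤ lam M * (y - x) :=
      mul_le_mul_of_nonneg_left (by linarith) hl.le
    linarith

lemma slope_in {M : ℕ} {s t : ℕ × ℕ × ℕ} (hs : s ∈ Idx M) (ht : t ∈ Idx M) (h : s.1 = t.1)
    (hlt : pos M s < pos M t) :
    crv M (pos M t) - crv M (pos M s) ≤ (4 * lam M * t.1 + 3 * lam M) * (pos M t - pos M s) ∧
    (4 * lam M * s.1 + lam M) * (pos M t - pos M s) ≤ crv M (pos M t) - crv M (pos M s) := by
  have hs' := mem_Idx.1 hs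
  have ht' := mem_Idx.1 ht
  have a := ofs_range hs'.2.1 hs'.2.2
  have b := ofs_range ht'.2.1 ht'.2.2
  have ex : pos M s = 4 * M * s.1 + ofs M s.2.1 s.2.2 := rfl
  have ey : pos M t = 4 * M * t.1 + ofs M t.2.1 t.2.2 := rfl
  rw [h] at ex ⊢
  have := crv_mid_bds (by omega) ht'.1 (x := pos M s) (y := pos M t) (by linarith) hlt.le
    (by linarith)
  exact ⟨this.2, this.1⟩

lemma cup_of_slopes {G : ℝ → ℝ} {x y z p q : ℝ} (hxy : x < y) (hyz : y < z)
    (h1 : G y - G x ≤ p * (y - x)) (h2 : q * (z - y) ≤ G z - G y) (hpq : p < q) :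
    Cup3 G x y z := by
  unfold Cup3
  have a := mul_le_mul_of_nonneg_right h1 (sub_pos.2 hyz).le
  have b := mul_le_mul_of_nonneg_right h2 (sub_pos.2 hxy).le
  have c := mul_pos (mul_pos (sub_pos.2 hxy) (sub_pos.2 hyz)) (sub_pos.2 hpq)
  nlinarith

lemma ori1 {M : ℕ} {s t u : ℕ × ℕ × ℕ} (hs : s ∈ Idx M) (ht : t ∈ Idx M) (hu : u ∈ Idx M)
    (hst : pos M s < pos M t) (htu : pos M t < pos M u) (hn : ¬ (s.1 = t.1 ∧ t.1 = u.1)) :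
    Cup3 (crv M) (pos M s) (pos M t) (pos M u) := by
  have hl : 0 < lam M := lam_pos (by have := mem_Idx.1 hs; omega)
  rcases (pos_fst hs ht hst).eq_or_lt with h | h
  · rcases (pos_fst ht hu htu).eq_or_lt with h' | h'
    · exact absurd ⟨h, h'⟩ hn
    · exact cup_of_slopes hst htu (slope_in hs ht h hst).1 (slope_up ht hu h').2 (by linarith)
  · rcases (pos_fst ht hu htu).eq_or_lt with h' | h'
    · exact cup_of_slopes hst htu (slope_up hs ht h).1 (slope_in ht hu h' htu).2 (by linarith)
    · exact cup_of_slopes hst htu (slope_up hs ht h).1 (slope_up ht hu h').2 (by linarith)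

lemma ori_cap {M : ℕ} {s t u : ℕ × ℕ × ℕ} (hs : s ∈ Idx M) (ht : t ∈ Idx M) (hu : u ∈ Idx M)
    (hst : pos M s < pos M t) (htu : pos M t < pos M u) (h1 : s.1 = t.1) (h2 : t.1 = u.1)
    (hn : ¬ (s.2.1 < t.2.1 ∧ t.2.1 = u.2.1)) :
    Cap3 (crv M) (pos M s) (pos M t) (pos M u) := by
  have a := pos_snd hs ht hst h1
  have b := pos_snd ht hu htu h2
  have hs' := mem_Idx.1 hs
  have ht' := mem_Idx.1 ht
  have hu' := mem_Idx.1 hu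
  exact crv_cap_of hs ht hu h1 h2
    (inn_ori_cap hu'.2.1 hs'.2.2 ht'.2.2 hu'.2.2 a.2 b.2 a.1 b.1 hn)

lemma ori_cup {M : ℕ} {s t u : ℕ × ℕ × ℕ} (hs : s ∈ Idx M) (ht : t ∈ Idx M) (hu : u ∈ Idx M)
    (hst : pos M s < pos M t) (htu : pos M t < pos M u) (h1 : s.1 = t.1) (h2 : t.1 = u.1)
    (hlt : s.2.1 < t.2.1) (heq : t.2.1 = u.2.1) :
    Cup3 (crv M) (pos M s) (pos M t) (pos M u) := by
  have a := pos_snd hs ht hst h1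
  have b := pos_snd ht hu htu h2
  have hs' := mem_Idx.1 hs
  have ht' := mem_Idx.1 ht
  have hu' := mem_Idx.1 hu
  refine crv_cup_of hs ht hu h1 h2 ?_
  have b1 := b.1
  rw [← heq] at b1 ⊢
  exact inn_ori_cup ht'.2.1 hs'.2.2 ht'.2.2 hu'.2.2 hlt a.1 b1

lemma not_cup_and_cap {G : ℝ → ℝ} {x y z : ℝ} (h : Cup3 G x y z) (h' : Cap3 G x y z) : False := by
  unfold Cup3 at h
  unfold Cap3 at h'
  linarith

lemma ori_any {M : ℕ} {s t u : ℕ × ℕ × ℕ} (hs : s ∈ Idx M) (ht : t ∈ Idx M) (hu : u ∈ Idx M)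
    (hst : pos M s < pos M t) (htu : pos M t < pos M u) :
    Cup3 (crv M) (pos M s) (pos M t) (pos M u) ∨ Cap3 (crv M) (pos M s) (pos M t) (pos M u) := by
  by_cases h : s.1 = t.1 ∧ t.1 = u.1
  · by_cases h' : s.2.1 < t.2.1 ∧ t.2.1 = u.2.1
    · exact Or.inl (ori_cup hs ht hu hst htu h.1 h.2 h'.1 h'.2)
    · exact Or.inr (ori_cap hs ht hu hst htu h.1 h.2 h')
  · exact Or.inl (ori1 hs ht hu hst htu h)

lemma collinear_eq {x y z a b c : ℝ} (h : Collinear ℝ ({(x, a), (y, b), (z, c)} : Set Pt)) :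
    (b - a) * (z - x) = (c - a) * (y - x) := by
  rw [collinear_iff_of_mem (p₀ := ((x, a) : Pt)) (by simp)] at h
  obtain ⟨v, hv⟩ := h
  obtain ⟨r, hr⟩ := hv (y, b) (by simp)
  obtain ⟨q, hq⟩ := hv (z, c) (by simp)
  simp only [vadd_eq_add, Prod.ext_iff, Prod.fst_add, Prod.snd_add, Prod.smul_fst, Prod.smul_snd,
    smul_eq_mul] at hr hq
  rw [hr.1, hr.2, hq.1, hq.2]
  ring

lemma seg_mem {C : Set Pt} (hC : Convex ℝ C) {x y z p q : ℝ} (hx : ((x, p) : Pt) ∈ C)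
    (hz : ((z, q) : Pt) ∈ C) (hxy : x < y) (hyz : y < z) :
    ((y, (p * (z - y) + q * (y - x)) / (z - x)) : Pt) ∈ C := by
  have h0 : 0 < z - x := by linarith
  have := hC hx hz (a := (z - y) / (z - x)) (b := (y - x) / (z - x))
    (div_nonneg (by linarith) h0.le) (div_nonneg (by linarith) h0.le) (by field_simp; ring)
  convert this using 1
  ext
  · simp; field_simp; ring
  · simp; field_simp

lemma vert_mem {C : Set Pt} (hC : Convex ℝ C) {y p q r : ℝ} (hp : ((y, p) : Pt) ∈ C)
    (hq : ((y, q) : Pt) ∈ C) (h1 : p ≤ r) (h2 : r ≤ q) : ((y, r) : Pt) ∈ C := by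
  rcases h1.eq_or_lt with rfl | h1
  · exact hp
  have h0 : 0 < q - p := by linarith
  have := hC hp hq (a := (q - r) / (q - p)) (b := (r - p) / (q - p))
    (div_nonneg (by linarith) h0.le) (div_nonneg (by linarith) h0.le) (by field_simp; ring)
  convert this using 1
  ext
  · simp; field_simp; ring
  · simp; field_simp; ring

lemma convex_split (G : ℝ → ℝ) (T : Finset ℝ)
    (hT : ConvexPos ((fun x => ((x, G x) : Pt)) '' (T : Set ℝ))) :
    ∃ T1 T2 : Finset ℝ, T1 ⊆ T ∧ T2 ⊆ T ∧ T = T1 ∪ T2 ∧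
      (∀ x ∈ T1, ∀ y ∈ T1, ∀ z ∈ T1, x < y → y < z → Cup3 G x y z) ∧
      (∀ x ∈ T2, ∀ y ∈ T2, ∀ z ∈ T2, x < y → y < z → Cap3 G x y z) := by
  classical
  rcases T.eq_empty_or_nonempty with rfl | hne
  · exact ⟨∅, ∅, by simp, by simp, by simp, by simp, by simp⟩
  set m := T.min' hne
  set n := T.max' hne
  have hm : m ∈ T := T.min'_mem hne
  have hn : n ∈ T := T.max'_mem hne
  have hml : ∀ x ∈ T, m ≤ x := fun x hx => T.min'_le x hx
  have hnl : ∀ x ∈ T, x ≤ n := fun x hx => T.le_max' x hx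
  have hmem : ∀ y x, x ∈ T → x ≠ y → ((x, G x) : Pt) ∈
      convexHull ℝ ((fun x => ((x, G x) : Pt)) '' (T : Set ℝ) \ {(y, G y)}) := by
    intro y x hx hxy
    refine subset_convexHull ℝ _ ⟨⟨x, hx, rfl⟩, ?_⟩
    simp [hxy]
  have key : ∀ y ∈ T, ∀ x ∈ T, ∀ z ∈ T, x < y → y < z →
      ∀ x' ∈ T, ∀ z' ∈ T, x' < y → y < z' →
      (G x * (z - y) + G z * (y - x)) / (z - x) ≤ G y →
      G y ≤ (G x' * (z' - y) + G z' * (y - x')) / (z' - x') → False := by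
    intro y hy x hx z hz hxy hyz x' hx' z' hz' hxy' hyz' h1 h2
    refine hT (y, G y) ⟨y, hy, rfl⟩ ?_
    have hC := convex_convexHull ℝ ((fun x => ((x, G x) : Pt)) '' (T : Set ℝ) \ {(y, G y)})
    exact vert_mem hC (seg_mem hC (hmem y x hx hxy.ne) (hmem y z hz hyz.ne') hxy hyz)
      (seg_mem hC (hmem y x' hx' hxy'.ne) (hmem y z' hz' hyz'.ne') hxy' hyz') h1 h2
  refine ⟨T.filter (fun y => G y * (n - m) ≤ G m * (n - y) + G n * (y - m)),
    T.filter (fun y => ¬ G y * (n - m) ≤ G m * (n - y) + G n * (y - m)),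
    Finset.filter_subset _ _, Finset.filter_subset _ _,
    (Finset.filter_union_filter_not_eq _ _).symm, ?_, ?_⟩
  · intro x hx y hy z hz hxy hyz
    rw [Finset.mem_filter] at hx hy hz
    have a1 := hml x hx.1
    have a2 := hnl z hz.1
    unfold Cup3
    by_contra hc
    refine key y hy.1 x hx.1 z hz.1 hxy hyz m hm n hn (by linarith) (by linarith) ?_ ?_
    · rw [div_le_iff₀ (by linarith)]; linarith
    · rw [le_div_iff₀ (by linarith)]; exact hy.2
  · intro x hx y hy z hz hxy hyz
    rw [Finset.mem_filter] at hx hy hz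
    have a1 := hml x hx.1
    have a2 := hnl z hz.1
    unfold Cap3
    by_contra hc
    refine key y hy.1 m hm n hn (by linarith) (by linarith) x hx.1 z hz.1 hxy hyz ?_ ?_
    · rw [div_le_iff₀ (by linarith)]; linarith [hy.2]
    · rw [le_div_iff₀ (by linarith)]; linarith

lemma four_sorted (T : Finset ℝ) (h : 4 ≤ T.card) :
    ∃ p ∈ T, ∃ q ∈ T, ∃ r ∈ T, ∃ s ∈ T, p < q ∧ q < r ∧ r < s := by
  obtain ⟨U, hU, hc⟩ := Finset.exists_subset_card_eq h
  let e := U.orderEmbOfFin hc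
  have he : ∀ i, e i ∈ T := fun i => hU (U.orderEmbOfFin_mem hc i)
  exact ⟨e 0, he 0, e 1, he 1, e 2, he 2, e 3, he 3, e.strictMono (by decide),
    e.strictMono (by decide), e.strictMono (by decide)⟩

lemma cup_card {M : ℕ} (S : Finset (ℕ × ℕ × ℕ)) (hS : S ⊆ Idx M)
    (h : ∀ s ∈ S, ∀ t ∈ S, ∀ u ∈ S, pos M s < pos M t → pos M t < pos M u →
      Cup3 (crv M) (pos M s) (pos M t) (pos M u)) : S.card ≤ 3 * M := by
  classical
  have h1 := Finset.card_le_mul_card_image_of_maps_to (s := S) (t := Finset.range M)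
    (f := fun t => t.1) (fun t ht => Finset.mem_range.2 (mem_Idx.1 (hS ht)).1) 3 (by
      intro i _
      by_contra hc
      have hc : 4 ≤ (S.filter (fun t => t.1 = i)).card := by omega
      have hinj : ((S.filter (fun t => t.1 = i)).image (pos M)).card =
          (S.filter (fun t => t.1 = i)).card := by
        refine Finset.card_image_of_injOn fun s hs t ht he => ?_
        exact pos_inj (hS (Finset.mem_filter.1 hs).1) (hS (Finset.mem_filter.1 ht).1) he
      rw [← hinj] at hc
      obtain ⟨_, hp', _, hq', _, hr', _, hs', h1, h2, h3⟩ := four_sorted _ hc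
      obtain ⟨p, hp, rfl⟩ := Finset.mem_image.1 hp'
      obtain ⟨q, hq, rfl⟩ := Finset.mem_image.1 hq'
      obtain ⟨r, hr, rfl⟩ := Finset.mem_image.1 hr'
      obtain ⟨s, hs, rfl⟩ := Finset.mem_image.1 hs'
      rw [Finset.mem_filter] at hp hq hr hs
      have e1 : q.2.1 = r.2.1 := by
        by_contra hne
        exact not_cup_and_cap (h p hp.1 q hq.1 r hr.1 h1 h2)
          (ori_cap (hS hp.1) (hS hq.1) (hS hr.1) h1 h2 (hp.2.trans hq.2.symm)
            (hq.2.trans hr.2.symm) (fun h => hne h.2))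
      exact not_cup_and_cap (h q hq.1 r hr.1 s hs.1 h2 h3)
        (ori_cap (hS hq.1) (hS hr.1) (hS hs.1) h2 h3 (hq.2.trans hr.2.symm)
          (hr.2.trans hs.2.symm) (fun h => by omega)))
  simpa using h1

lemma cap_card {M : ℕ} (hM : 0 < M) (S : Finset (ℕ × ℕ × ℕ)) (hS : S ⊆ Idx M)
    (h : ∀ s ∈ S, ∀ t ∈ S, ∀ u ∈ S, pos M s < pos M t → pos M t < pos M u →
      Cap3 (crv M) (pos M s) (pos M t) (pos M u)) : S.card ≤ 3 * M := by
  classical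
  rcases S.eq_empty_or_nonempty with rfl | hne
  · simp
  obtain ⟨p, hp, hmin⟩ := S.exists_min_image (pos M) hne
  have hlt : ∀ t ∈ S, t ≠ p → pos M p < pos M t := fun t ht hn =>
    lt_of_le_of_ne (hmin t ht) (fun he => hn (pos_inj (hS ht) (hS hp) he.symm))
  have hsplit : S = S.filter (fun t => t.1 ≠ p.1) ∪
      (S.filter (fun t => t.1 = p.1 ∧ t.2.1 = p.2.1) ∪
       S.filter (fun t => t.1 = p.1 ∧ t.2.1 ≠ p.2.1)) := by
    ext t
    simp only [Finset.mem_union, Finset.mem_filter]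
    tauto
  have hA : (S.filter (fun t => t.1 ≠ p.1)).card ≤ 1 := by
    rw [Finset.card_le_one]
    have : ∀ a ∈ S, ∀ b ∈ S, a.1 ≠ p.1 → pos M a < pos M b → False := by
      intro a ha b hb hap hab
      have hpa := hlt a ha (fun e => hap (by rw [e]))
      exact not_cup_and_cap (ori1 (hS hp) (hS ha) (hS hb) hpa hab (fun e => hap e.1.symm))
        (h p hp a ha b hb hpa hab)
    intro a ha b hb
    rw [Finset.mem_filter] at ha hb
    rcases lt_trichotomy (pos M a) (pos M b) with hab | hab | hab
    · exact (this a ha.1 b hb.1 ha.2 hab).elim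
    · exact pos_inj (hS ha.1) (hS hb.1) hab
    · exact (this b hb.1 a ha.1 hb.2 hab).elim
  have hB : (S.filter (fun t => t.1 = p.1 ∧ t.2.1 = p.2.1)).card ≤ M := by
    have := Finset.card_le_card_of_injOn (s := S.filter (fun t => t.1 = p.1 ∧ t.2.1 = p.2.1))
      (t := Finset.range M) (fun t => t.2.2)
      (fun t ht => Finset.mem_coe.2 (Finset.mem_range.2
        (mem_Idx.1 (hS (Finset.mem_filter.1 ht).1)).2.2))
      (by
        intro a ha b hb hab
        have ha := (Finset.mem_filter.1 ha).2
        have hb := (Finset.mem_filter.1 hb).2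
        exact Prod.ext (ha.1.trans hb.1.symm) (Prod.ext (ha.2.trans hb.2.symm) hab))
    simpa using this
  have hC : (S.filter (fun t => t.1 = p.1 ∧ t.2.1 ≠ p.2.1)).card ≤ M := by
    have hk : ∀ a ∈ S, ∀ b ∈ S, a.1 = p.1 → b.1 = p.1 → a.2.1 ≠ p.2.1 → a.2.1 = b.2.1 →
        pos M a < pos M b → False := by
      intro a ha b hb ha1 hb1 hap heq hab
      have hpa := hlt a ha (fun e => hap (by rw [e]))
      have hle := (pos_snd (hS hp) (hS ha) hpa ha1.symm).2
      exact not_cup_and_cap (ori_cup (hS hp) (hS ha) (hS hb) hpa hab ha1.symm (ha1.trans hb1.symm)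
        (lt_of_le_of_ne hle (Ne.symm hap)) heq) (h p hp a ha b hb hpa hab)
    have := Finset.card_le_card_of_injOn (s := S.filter (fun t => t.1 = p.1 ∧ t.2.1 ≠ p.2.1))
      (t := Finset.range M) (fun t => t.2.1)
      (fun t ht => Finset.mem_coe.2 (Finset.mem_range.2
        (mem_Idx.1 (hS (Finset.mem_filter.1 ht).1)).2.1))
      (by
        intro a ha b hb hab
        have ha := Finset.mem_filter.1 ha
        have hb := Finset.mem_filter.1 hb
        simp only at hab
        rcases lt_trichotomy (pos M a) (pos M b) with hl | hl | hl
        · exact (hk a ha.1 b hb.1 ha.2.1 hb.2.1 ha.2.2 hab hl).elim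
        · exact pos_inj (hS ha.1) (hS hb.1) hl
        · exact (hk b hb.1 a ha.1 hb.2.1 ha.2.1 hb.2.2 hab.symm hl).elim)
    simpa using this
  rw [hsplit]
  refine (Finset.card_union_le _ _).trans ?_
  have := Finset.card_union_le (S.filter (fun t => t.1 = p.1 ∧ t.2.1 = p.2.1))
    (S.filter (fun t => t.1 = p.1 ∧ t.2.1 ≠ p.2.1))
  omega

lemma pull_card {M : ℕ} (T : Finset ℝ) (hT : T ⊆ (Idx M).image (pos M)) :
    T.card ≤ ((Idx M).filter (fun t => pos M t ∈ T)).card := by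
  classical
  refine (Finset.card_le_card ?_).trans (Finset.card_image_le (f := pos M))
  intro x hx
  obtain ⟨t, ht, rfl⟩ := Finset.mem_image.1 (hT hx)
  exact Finset.mem_image.2 ⟨t, Finset.mem_filter.2 ⟨ht, hx⟩, rfl⟩

/-- Theorem 3.2. -/
theorem stmt_6 : ∃ C : ℝ, 0 < C ∧ ∀ M : ℕ, 0 < M →
    ∃ X : Finset Pt, X.card = M ^ 3 ∧ GenPos ↑X ∧
      (∃ J, IsJordanCurve J ∧ StabLE J 22 ∧ (↑X : Set Pt) ⊆ J) ∧
      ∀ Y ⊆ X, ConvexPos ↑Y → (Y.card : ℝ) ≤ C * M := by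
  classical
  refine ⟨6, by norm_num, fun M hM => ?_⟩
  have hM' : (0 : ℝ) < M := by exact_mod_cast hM
  have hmemX : ∀ p, p ∈ (Idx M).image (fun t => ((pos M t, crv M (pos M t)) : Pt)) ↔
      ∃ t ∈ Idx M, ((pos M t, crv M (pos M t)) : Pt) = p := fun p => Finset.mem_image
  refine ⟨(Idx M).image (fun t => ((pos M t, crv M (pos M t)) : Pt)), ?_, ?_, ?_, ?_⟩
  · rw [Finset.card_image_of_injOn]
    · simp [Idx]; ring
    · intro s hs t ht he
      exact pos_inj hs ht (congrArg Prod.fst he)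
  · intro p hp q hq r hr hpq hpr hqr hcol
    obtain ⟨s, hs, rfl⟩ := (hmemX p).1 hp
    obtain ⟨t, ht, rfl⟩ := (hmemX q).1 hq
    obtain ⟨u, hu, rfl⟩ := (hmemX r).1 hr
    have e := collinear_eq hcol
    have h1 : pos M s ≠ pos M t := fun h => hpq (by rw [h])
    have h2 : pos M s ≠ pos M u := fun h => hpr (by rw [h])
    have h3 : pos M t ≠ pos M u := fun h => hqr (by rw [h])
    have fin : ∀ a ∈ Idx M, ∀ b ∈ Idx M, ∀ c ∈ Idx M, pos M a < pos M b → pos M b < pos M c →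
        (crv M (pos M b) - crv M (pos M a)) * (pos M c - pos M b) ≠
        (crv M (pos M c) - crv M (pos M b)) * (pos M b - pos M a) := by
      intro a ha b hb c hc hab hbc
      rcases ori_any ha hb hc hab hbc with h | h
      · exact ne_of_lt h
      · exact ne_of_gt h
    rcases lt_or_gt_of_ne h1 with h1 | h1 <;> rcases lt_or_gt_of_ne h2 with h2 | h2 <;>
      rcases lt_or_gt_of_ne h3 with h3 | h3
    · exact fin s hs t ht u hu h1 h3 (by linarith)
    · exact fin s hs u hu t ht h2 h3 (by linarith)
    · linarith
    · exact fin u hu s hs t ht h2 h1 (by linarith)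
    · exact fin t ht s hs u hu h1 h2 (by linarith)
    · linarith
    · exact fin t ht u hu s hs h3 h2 (by linarith)
    · exact fin u hu t ht s hs h3 h1 (by linarith)
  · have hl := lam_pos hM
    obtain ⟨J, hJ, hst, hin⟩ := close_up (G := crv M) (B := 4 * M * M) (K := 4 * lam M * M)
      (by positivity)
      (fun x y hxy => by
        have := crv_lip hM hxy
        rw [abs_of_nonneg this.1]
        exact this.2) crv_cont (crv_cov hM _)
    refine ⟨J, hJ, hst, ?_⟩
    intro p hp
    obtain ⟨t, ht, rfl⟩ := (hmemX p).1 hp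
    refine hin _ ?_
    have ht := mem_Idx.1 ht
    have h1 := ofs_range ht.2.1 ht.2.2
    have h2 : (t.1 : ℝ) + 1 ≤ M := by exact_mod_cast ht.1
    have h3 : (4 * M : ℝ) * (t.1 + 1) ≤ 4 * M * M := by gcongr
    have h4 : (0 : ℝ) ≤ 4 * M * t.1 := by positivity
    unfold pos
    constructor <;> linarith
  · intro Y hY hconv
    set T : Finset ℝ := Y.image Prod.fst with hT
    have hYg : ∀ p ∈ Y, p = (p.1, crv M p.1) := by
      intro p hp
      obtain ⟨t, ht, rfl⟩ := (hmemX p).1 (hY hp)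
      rfl
    have hcard : T.card = Y.card := by
      refine Finset.card_image_of_injOn fun p hp q hq h => ?_
      rw [hYg p hp, hYg q hq, h]
    have hTI : T ⊆ (Idx M).image (pos M) := by
      intro x hx
      obtain ⟨p, hp, rfl⟩ := Finset.mem_image.1 hx
      obtain ⟨t, ht, rfl⟩ := (hmemX p).1 (hY hp)
      exact Finset.mem_image.2 ⟨t, ht, rfl⟩
    have hYT : (Y : Set Pt) = (fun x => ((x, crv M x) : Pt)) '' (T : Set ℝ) := by
      ext p
      constructor
      · intro hp
        exact ⟨p.1, Finset.mem_coe.2 (Finset.mem_image.2 ⟨p, hp, rfl⟩), (hYg p hp).symm⟩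
      · rintro ⟨x, hx, rfl⟩
        obtain ⟨p, hp, rfl⟩ := Finset.mem_image.1 (Finset.mem_coe.1 hx)
        show (p.1, crv M p.1) ∈ (Y : Set Pt)
        rw [← hYg p hp]
        exact hp
    rw [hYT] at hconv
    obtain ⟨T1, T2, s1, s2, hU, hcup, hcap⟩ := convex_split (crv M) T hconv
    have c1 := (pull_card T1 (s1.trans hTI)).trans (cup_card _ (Finset.filter_subset _ _) (by
      intro s hs t ht u hu
      exact hcup _ (Finset.mem_filter.1 hs).2 _ (Finset.mem_filter.1 ht).2 _
        (Finset.mem_filter.1 hu).2))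
    have c2 := (pull_card T2 (s2.trans hTI)).trans (cap_card hM _ (Finset.filter_subset _ _) (by
      intro s hs t ht u hu
      exact hcap _ (Finset.mem_filter.1 hs).2 _ (Finset.mem_filter.1 ht).2 _
        (Finset.mem_filter.1 hu).2))
    have c3 := Finset.card_union_le T1 T2
    rw [← hU, hcard] at c3
    have : Y.card ≤ 6 * M := by omega
    exact_mod_cast this
end
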